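/- For all b > 0 and all R > 0 with R² = 2πN for some positive integer N, one has m_p(b,R) ≤ ([1−b]_+)² c(R). Furthermore, there exist universal constants ε₀ ∈ (0,1) and C > 0 such that if R ≥ 2 (with R² = 2πN), b ≥ 1−ε₀ and 0 < σ < 1/2, then m_p(b,R) ≥ ([1−b]_+)² ( (1+2σ) c(R) − C σ^{−3} (1−b)² R⁴ ). -/

import Mathlib

open MeasureTheory Filter Set

noncomputable section

/-- The canonical 2D magnetic potential `A₀(x) = (-x₂/2, x₁/2)`. -/
def A0 (x : ℝ × ℝ) : ℝ × ℝ := (-x.2 / 2, x.1 / 2)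

/-- The open square `K_R = (-R/2, R/2) × (-R/2, R/2)` in `ℝ²`. -/
def KR (R : ℝ) : Set (ℝ × ℝ) := Ioo (-R/2) (R/2) ×ˢ Ioo (-R/2) (R/2)

/-- First component of the magnetic gradient `(∇ - iA₀)u`. -/
def D1 (u : ℝ × ℝ → ℂ) (x : ℝ × ℝ) : ℂ :=
  fderiv ℝ u x (1, 0) - Complex.I * ((A0 x).1 : ℂ) * u x

/-- Second component of the magnetic gradient `(∇ - iA₀)u`. -/
def D2 (u : ℝ × ℝ → ℂ) (x : ℝ × ℝ) : ℂ :=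
  fderiv ℝ u x (0, 1) - Complex.I * ((A0 x).2 : ℂ) * u x

/-- The two-dimensional Ginzburg–Landau energy `G_{b,K_R}(u)`. -/
def G2 (b R : ℝ) (u : ℝ × ℝ → ℂ) : ℝ :=
  ∫ x in KR R, (b * (‖D1 u x‖ ^ 2 + ‖D2 u x‖ ^ 2) - ‖u x‖ ^ 2 + (1/2) * ‖u x‖ ^ 4)

/-- `m₀(b,R)`: the ground state energy of `G_{b,K_R}` with Dirichlet boundary conditions,
realized (by density) as the infimum over smooth functions compactly supported in `K_R`. -/
def m0 (b R : ℝ) : ℝ :=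
  sInf {E : ℝ | ∃ u : ℝ × ℝ → ℂ, ContDiff ℝ (⊤ : ℕ∞) u ∧ HasCompactSupport u ∧
    tsupport u ⊆ KR R ∧ E = G2 b R u}

/-- The magnetic periodicity conditions defining the space `E_R`. -/
def MagPeriodic (R : ℝ) (u : ℝ × ℝ → ℂ) : Prop :=
  ∀ x : ℝ × ℝ,
    u (x.1 + R, x.2) = Complex.exp (Complex.I * (R * x.2 / 2)) * u x ∧
    u (x.1, x.2 + R) = Complex.exp (-(Complex.I * (R * x.1 / 2))) * u x

/-- `m_p(b,R)`: the ground state energy of `G_{b,K_R}` over the magnetically periodic space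
`E_R`, realized (by elliptic regularity/density) over smooth magnetic periodic functions. -/
def mp (b R : ℝ) : ℝ :=
  sInf {E : ℝ | ∃ u : ℝ × ℝ → ℂ, ContDiff ℝ (⊤ : ℕ∞) u ∧ MagPeriodic R u ∧ E = G2 b R u}

/-- The lowest Landau band equation `(∂₁ + i∂₂ + (1/2)(x₁ + ix₂))u = 0`. -/
def LLL (u : ℝ × ℝ → ℂ) : Prop :=
  ∀ x : ℝ × ℝ,
    fderiv ℝ u x (1, 0) + Complex.I * fderiv ℝ u x (0, 1)
      + (1/2 : ℂ) * ((x.1 : ℂ) + Complex.I * (x.2 : ℂ)) * u x = 0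

/-- The Abrikosov energy `F_R(v) = ∫_{K_R} (-|v|² + (1/2)|v|⁴)`. -/
def FAb (R : ℝ) (v : ℝ × ℝ → ℂ) : ℝ :=
  ∫ x in KR R, (-‖v x‖ ^ 2 + (1/2) * ‖v x‖ ^ 4)

/-- `c(R)`: the minimal Abrikosov energy over the lowest Landau band `L_R`. -/
def cAb (R : ℝ) : ℝ :=
  sInf {E : ℝ | ∃ u : ℝ × ℝ → ℂ, ContDiff ℝ (⊤ : ℕ∞) u ∧ MagPeriodic R u ∧ LLL u ∧ E = FAb R u}

/-- The thermodynamic limit function `g(b) = lim_{R→∞} m₀(b,R)/R²`. -/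
def gfun (b : ℝ) : ℝ := limUnder atTop (fun R : ℝ => m0 b R / R ^ 2)

/-- The canonical 3D magnetic potential `F(x) = (-x₂/2, x₁/2, 0)`. -/
def Fpot (x : ℝ × ℝ × ℝ) : ℝ × ℝ × ℝ := (-x.2.1 / 2, x.1 / 2, 0)

/-- The open cube `Q_R = (-R/2, R/2)³` in `ℝ³`. -/
def QR (R : ℝ) : Set (ℝ × ℝ × ℝ) :=
  Ioo (-R/2) (R/2) ×ˢ Ioo (-R/2) (R/2) ×ˢ Ioo (-R/2) (R/2)

/-- First component of the 3D magnetic gradient `(∇ - iF)u`. -/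
def DD1 (u : ℝ × ℝ × ℝ → ℂ) (x : ℝ × ℝ × ℝ) : ℂ :=
  fderiv ℝ u x (1, 0, 0) - Complex.I * ((Fpot x).1 : ℂ) * u x

/-- Second component of the 3D magnetic gradient `(∇ - iF)u`. -/
def DD2 (u : ℝ × ℝ × ℝ → ℂ) (x : ℝ × ℝ × ℝ) : ℂ :=
  fderiv ℝ u x (0, 1, 0) - Complex.I * ((Fpot x).2.1 : ℂ) * u x

/-- Third component of the 3D magnetic gradient `(∇ - iF)u`. -/
def DD3 (u : ℝ × ℝ × ℝ → ℂ) (x : ℝ × ℝ × ℝ) : ℂ :=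
  fderiv ℝ u x (0, 0, 1) - Complex.I * ((Fpot x).2.2 : ℂ) * u x

/-- The three-dimensional Ginzburg–Landau energy `F³ᴰ_{b,Q_R}(u)`. -/
def G3 (b R : ℝ) (u : ℝ × ℝ × ℝ → ℂ) : ℝ :=
  ∫ x in QR R, (b * (‖DD1 u x‖ ^ 2 + ‖DD2 u x‖ ^ 2 + ‖DD3 u x‖ ^ 2)
    - ‖u x‖ ^ 2 + (1/2) * ‖u x‖ ^ 4)

/-- `M₀(b,R)`: the 3D ground state energy with Dirichlet boundary conditions. -/
def M0 (b R : ℝ) : ℝ :=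
  sInf {E : ℝ | ∃ u : ℝ × ℝ × ℝ → ℂ, ContDiff ℝ (⊤ : ℕ∞) u ∧ HasCompactSupport u ∧
    tsupport u ⊆ QR R ∧ E = G3 b R u}

end

open scoped ENNReal Topology

/-- The annihilation operator `D₁ + i D₂`, whose kernel is the lowest Landau band. -/
noncomputable def aOp (u : ℝ × ℝ → ℂ) (x : ℝ × ℝ) : ℂ := D1 u x + Complex.I * D2 u x

theorem aOp_eq (u : ℝ × ℝ → ℂ) (x : ℝ × ℝ) :
    aOp u x = fderiv ℝ u x (1, 0) + Complex.I * fderiv ℝ u x (0, 1)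
      + (1/2 : ℂ) * ((x.1 : ℂ) + Complex.I * (x.2 : ℂ)) * u x := by
  simp only [aOp, D1, D2, A0]
  push_cast
  linear_combination (-(1/2) * (x.1 : ℂ) * u x) * Complex.I_sq

theorem lll_iff_aOp_eq_zero (u : ℝ × ℝ → ℂ) : LLL u ↔ ∀ x, aOp u x = 0 := by
  simp only [LLL, aOp_eq]

/-- The phase of the magnetic translation by `p`. -/
noncomputable def magPhase (p z : ℝ × ℝ) : ℂ :=
  Complex.exp (-(Complex.I / 2) * ((p.1 * z.2 - p.2 * z.1 : ℝ) : ℂ))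

/-- The magnetic translation by `p`. -/
noncomputable def magTrans (p : ℝ × ℝ) (u : ℝ × ℝ → ℂ) (z : ℝ × ℝ) : ℂ :=
  magPhase p z * u (p + z)

theorem norm_magPhase (p z : ℝ × ℝ) : ‖magPhase p z‖ = 1 := by
  rw [magPhase, Complex.norm_exp]
  simp

theorem norm_magTrans (p : ℝ × ℝ) (u : ℝ × ℝ → ℂ) (z : ℝ × ℝ) :
    ‖magTrans p u z‖ = ‖u (p + z)‖ := by
  rw [magTrans, norm_mul, norm_magPhase, one_mul]

theorem contDiff_magPhase (p : ℝ × ℝ) {n : WithTop ℕ∞} : ContDiff ℝ n (magPhase p) := by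
  unfold magPhase
  have h : ContDiff ℝ n (fun z : ℝ × ℝ => p.1 * z.2 - p.2 * z.1) := by fun_prop
  exact (contDiff_const.mul (Complex.ofRealCLM.contDiff.comp h)).cexp

theorem contDiff_magTrans (p : ℝ × ℝ) {u : ℝ × ℝ → ℂ} {n : WithTop ℕ∞} (hu : ContDiff ℝ n u) :
    ContDiff ℝ n (magTrans p u) :=
  (contDiff_magPhase p).mul (hu.comp (contDiff_const.add contDiff_id))

theorem fderiv_magPhase (p z v : ℝ × ℝ) :
    fderiv ℝ (magPhase p) z v =
      magPhase p z * (-(Complex.I / 2) * ((p.1 * v.2 - p.2 * v.1 : ℝ) : ℂ)) := by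
  have h1 : HasFDerivAt (fun z : ℝ × ℝ => p.1 * z.2 - p.2 * z.1)
      (p.1 • ContinuousLinearMap.snd ℝ ℝ ℝ - p.2 • ContinuousLinearMap.fst ℝ ℝ ℝ) z :=
    (hasFDerivAt_snd.const_mul p.1).sub (hasFDerivAt_fst.const_mul p.2)
  have h2 := ((Complex.ofRealCLM.hasFDerivAt.comp z h1).const_mul (-(Complex.I / 2))).cexp
  have h3 : HasFDerivAt (magPhase p) _ z := h2
  rw [h3.fderiv]
  simp [magPhase]

theorem fderiv_magTrans (p : ℝ × ℝ) {u : ℝ × ℝ → ℂ} (hu : Differentiable ℝ u) (z v : ℝ × ℝ) :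
    fderiv ℝ (magTrans p u) z v =
      magPhase p z * (fderiv ℝ u (p + z) v
        - (Complex.I / 2) * ((p.1 * v.2 - p.2 * v.1 : ℝ) : ℂ) * u (p + z)) := by
  have h1 : HasFDerivAt (fun z => u (p + z)) (fderiv ℝ u (p + z)) z := by
    have := (hu (p + z)).hasFDerivAt.comp z ((hasFDerivAt_id z).const_add p)
    rwa [ContinuousLinearMap.comp_id] at this
  have h0 : HasFDerivAt (magPhase p) (fderiv ℝ (magPhase p) z) z :=
    ((contDiff_magPhase p (n := 1)).differentiable (by norm_num) z).hasFDerivAt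
  have h2 : HasFDerivAt (magTrans p u) _ z := h0.mul h1
  rw [h2.fderiv]
  simp [fderiv_magPhase]
  ring

theorem D1_magTrans (p : ℝ × ℝ) {u : ℝ × ℝ → ℂ} (hu : Differentiable ℝ u) :
    D1 (magTrans p u) = magTrans p (D1 u) := by
  funext z
  simp only [D1, fderiv_magTrans p hu, A0, magTrans, Prod.fst_add, Prod.snd_add]
  push_cast
  ring

theorem D2_magTrans (p : ℝ × ℝ) {u : ℝ × ℝ → ℂ} (hu : Differentiable ℝ u) :
    D2 (magTrans p u) = magTrans p (D2 u) := by
  funext z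
  simp only [D2, fderiv_magTrans p hu, A0, magTrans, Prod.fst_add, Prod.snd_add]
  push_cast
  ring

theorem aOp_magTrans (p : ℝ × ℝ) {u : ℝ × ℝ → ℂ} (hu : Differentiable ℝ u) :
    aOp (magTrans p u) = magTrans p (aOp u) := by
  funext z
  simp only [aOp, D1_magTrans p hu, D2_magTrans p hu, magTrans]
  ring

theorem magPeriodic_iff (R : ℝ) (u : ℝ × ℝ → ℂ) :
    MagPeriodic R u ↔ magTrans (R, 0) u = u ∧ magTrans (0, R) u = u := by
  have key : ∀ (a b : ℂ) (t : ℂ), Complex.exp (-t) * a = b ↔ a = Complex.exp t * b := by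
    intro a b t
    rw [Complex.exp_neg, inv_mul_eq_iff_eq_mul₀ (Complex.exp_ne_zero t)]
  simp only [MagPeriodic, funext_iff, magTrans, magPhase, ← forall_and]
  refine forall_congr' fun x => and_congr ?_ ?_
  · rw [← key]
    refine Eq.congr (congrArg₂ _ (congrArg _ ?_) (congrArg u ?_)) rfl
    · push_cast; ring
    · ext <;> simp [add_comm]
  · rw [← key]
    refine Eq.congr (congrArg₂ _ (congrArg _ ?_) (congrArg u ?_)) rfl
    · push_cast; ring
    · ext <;> simp [add_comm]

theorem MagPeriodic.D1 {R : ℝ} {u : ℝ × ℝ → ℂ} (h : MagPeriodic R u) (hu : Differentiable ℝ u) :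
    MagPeriodic R (D1 u) := by
  rw [magPeriodic_iff] at h ⊢
  rw [← D1_magTrans _ hu, ← D1_magTrans _ hu, h.1, h.2]
  exact ⟨rfl, rfl⟩

theorem MagPeriodic.D2 {R : ℝ} {u : ℝ × ℝ → ℂ} (h : MagPeriodic R u) (hu : Differentiable ℝ u) :
    MagPeriodic R (D2 u) := by
  rw [magPeriodic_iff] at h ⊢
  rw [← D2_magTrans _ hu, ← D2_magTrans _ hu, h.1, h.2]
  exact ⟨rfl, rfl⟩

theorem MagPeriodic.aOp {R : ℝ} {u : ℝ × ℝ → ℂ} (h : MagPeriodic R u) (hu : Differentiable ℝ u) :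
    MagPeriodic R (aOp u) := by
  rw [magPeriodic_iff] at h ⊢
  rw [← aOp_magTrans _ hu, ← aOp_magTrans _ hu, h.1, h.2]
  exact ⟨rfl, rfl⟩

theorem MagPeriodic.const_mul {R : ℝ} {u : ℝ × ℝ → ℂ} (h : MagPeriodic R u) (k : ℂ) :
    MagPeriodic R (fun x => k * u x) := by
  intro x
  simp only [(h x).1, (h x).2]
  constructor <;> ring

theorem MagPeriodic.sub {R : ℝ} {u v : ℝ × ℝ → ℂ} (hu : MagPeriodic R u) (hv : MagPeriodic R v) :
    MagPeriodic R (fun x => u x - v x) := by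
  intro x
  simp only [(hu x).1, (hu x).2, (hv x).1, (hv x).2]
  constructor <;> ring

/-- Periodicity with period `R` in each of the two variables. -/
def DoublyPeriodic {α : Type*} (R : ℝ) (f : ℝ × ℝ → α) : Prop :=
  ∀ x : ℝ × ℝ, f (x.1 + R, x.2) = f x ∧ f (x.1, x.2 + R) = f x

theorem DoublyPeriodic.comp {α β : Type*} {R : ℝ} {f : ℝ × ℝ → α} (h : DoublyPeriodic R f)
    (g : α → β) : DoublyPeriodic R (fun x => g (f x)) :=
  fun x => ⟨congrArg g (h x).1, congrArg g (h x).2⟩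

/-- Products `u v̄` of magnetically periodic functions are doubly periodic. -/
theorem MagPeriodic.mul_conj {R : ℝ} {u v : ℝ × ℝ → ℂ} (hu : MagPeriodic R u)
    (hv : MagPeriodic R v) : DoublyPeriodic R (fun x => u x * (starRingEnd ℂ) (v x)) := by
  have key : ∀ t : ℝ, Complex.exp (Complex.I * t) *
      (starRingEnd ℂ) (Complex.exp (Complex.I * t)) = 1 := by
    intro t
    rw [Complex.mul_conj, Complex.normSq_eq_norm_sq, mul_comm, Complex.norm_exp_ofReal_mul_I]
    simp
  have h1 : ∀ a b e : ℂ, e * (starRingEnd ℂ) e = 1 →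
      e * a * (starRingEnd ℂ) (e * b) = a * (starRingEnd ℂ) b := by
    intro a b e he
    rw [map_mul]
    linear_combination a * (starRingEnd ℂ) b * he
  intro x
  simp only [(hu x).1, (hu x).2, (hv x).1, (hv x).2]
  constructor
  · apply h1
    have := key (R * x.2 / 2)
    push_cast at this
    exact this
  · apply h1
    have := key (-(R * x.1 / 2))
    push_cast at this
    simpa using this

theorem MagPeriodic.norm {R : ℝ} {u : ℝ × ℝ → ℂ} (hu : MagPeriodic R u) :
    DoublyPeriodic R (fun x => ‖u x‖) := by
  have := (hu.mul_conj hu).comp fun z => Real.sqrt ‖z‖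
  simpa using this

theorem DoublyPeriodic.exists_bound {R : ℝ} (hR : 0 < R) {f : ℝ × ℝ → ℝ}
    (h : DoublyPeriodic R f) (hf : Continuous f) : ∃ M, ∀ x, f x ≤ M := by
  obtain ⟨M, hM⟩ := ((isCompact_Icc (a := (0 : ℝ)) (b := R)).prod
    (isCompact_Icc (a := (0 : ℝ)) (b := R))).bddAbove_image hf.continuousOn
  refine ⟨M, fun x => ?_⟩
  have p1 : ∀ t, Function.Periodic (fun s => f (s, t)) R := fun t s => (h (s, t)).1
  have p2 : ∀ s, Function.Periodic (fun t => f (s, t)) R := fun s t => (h (s, t)).2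
  obtain ⟨y1, hy1, e1⟩ := (p1 x.2).exists_mem_Ico₀ hR x.1
  obtain ⟨y2, hy2, e2⟩ := (p2 y1).exists_mem_Ico₀ hR x.2
  have : f x = f (y1, y2) := by rw [← e2]; exact e1
  rw [this]
  exact hM ⟨(y1, y2), ⟨Ico_subset_Icc_self hy1, Ico_subset_Icc_self hy2⟩, rfl⟩

theorem contDiff_D1 {u : ℝ × ℝ → ℂ} (hu : ContDiff ℝ (⊤ : ℕ∞) u) :
    ContDiff ℝ (⊤ : ℕ∞) (D1 u) := by
  unfold D1 A0
  have h0 : ContDiff ℝ (⊤ : ℕ∞) (fun x : ℝ × ℝ => -x.2 / 2) := by fun_prop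
  have h1 : ContDiff ℝ (⊤ : ℕ∞) (fun x : ℝ × ℝ => ((-x.2 / 2 : ℝ) : ℂ)) :=
    Complex.ofRealCLM.contDiff.comp h0
  exact ((hu.fderiv_right (by simp)).clm_apply contDiff_const).sub
    ((contDiff_const.mul h1).mul hu)

theorem contDiff_D2 {u : ℝ × ℝ → ℂ} (hu : ContDiff ℝ (⊤ : ℕ∞) u) :
    ContDiff ℝ (⊤ : ℕ∞) (D2 u) := by
  unfold D2 A0
  have h0 : ContDiff ℝ (⊤ : ℕ∞) (fun x : ℝ × ℝ => x.1 / 2) := by fun_prop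
  have h1 : ContDiff ℝ (⊤ : ℕ∞) (fun x : ℝ × ℝ => ((x.1 / 2 : ℝ) : ℂ)) :=
    Complex.ofRealCLM.contDiff.comp h0
  exact ((hu.fderiv_right (by simp)).clm_apply contDiff_const).sub
    ((contDiff_const.mul h1).mul hu)

theorem contDiff_aOp {u : ℝ × ℝ → ℂ} (hu : ContDiff ℝ (⊤ : ℕ∞) u) :
    ContDiff ℝ (⊤ : ℕ∞) (aOp u) :=
  (contDiff_D1 hu).add (contDiff_const.mul (contDiff_D2 hu))

theorem setLIntegral_Ioo_periodic_add {R : ℝ} (hR : 0 < R) {f : ℝ → ℝ≥0∞}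
    (hf : Function.Periodic f R) (z : ℝ) :
    ∫⁻ x in Ioo (-R/2) (R/2), f (z + x) = ∫⁻ x in Ioo (-R/2) (R/2), f x := by
  rw [restrict_Ioo_eq_restrict_Ioc]
  have h1 := (measurePreserving_add_left (volume : Measure ℝ) z).setLIntegral_comp_preimage_emb
    (measurableEmbedding_addLeft z) f (Ioc (z + -R/2) (z + -R/2 + R))
  have e1 : (fun x => z + x) ⁻¹' Ioc (z + -R/2) (z + -R/2 + R) = Ioc (-R/2) (R/2) := by
    ext x
    simp only [mem_preimage, mem_Ioc]
    constructor <;> rintro ⟨h1, h2⟩ <;> constructor <;> linarith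
  rw [e1] at h1
  rw [h1]
  have e2 : Ioc (-R/2) (R/2) = Ioc (-R/2) (-R/2 + R) := by congr 1; ring
  rw [e2]
  refine (isAddFundamentalDomain_Ioc hR _).setLIntegral_eq (isAddFundamentalDomain_Ioc hR _) f ?_
  rintro ⟨g, hg⟩ x
  obtain ⟨n, rfl⟩ := AddSubgroup.mem_zmultiples_iff.1 hg
  have : (⟨n • R, hg⟩ : AddSubgroup.zmultiples R) +ᵥ x = x + n • R := by
    rw [AddSubgroup.vadd_def, vadd_eq_add, add_comm]
  rw [this]
  exact hf.zsmul n x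

theorem volume_restrict_KR (R : ℝ) : (volume : Measure (ℝ × ℝ)).restrict (KR R) =
    (volume.restrict (Ioo (-R/2) (R/2))).prod (volume.restrict (Ioo (-R/2) (R/2))) := by
  rw [KR, Measure.volume_eq_prod, Measure.prod_restrict]

theorem measurableSet_KR (R : ℝ) : MeasurableSet (KR R) := measurableSet_Ioo.prod measurableSet_Ioo

theorem volume_KR {R : ℝ} (hR : 0 ≤ R) : volume (KR R) = ENNReal.ofReal (R ^ 2) := by
  rw [KR, Measure.volume_eq_prod, Measure.prod_prod, Real.volume_Ioo,
    ← ENNReal.ofReal_mul (by linarith)]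
  congr 1
  ring

theorem DoublyPeriodic.setLIntegral_add {R : ℝ} (hR : 0 < R) {ψ : ℝ × ℝ → ℝ≥0∞}
    (hψ : DoublyPeriodic R ψ) (hm : Measurable ψ) (z : ℝ × ℝ) :
    ∫⁻ x in KR R, ψ (z + x) = ∫⁻ x in KR R, ψ x := by
  rw [volume_restrict_KR, lintegral_prod _ (by fun_prop), lintegral_prod _ (by fun_prop)]
  have h1 : ∀ x1, ∫⁻ x2 in Ioo (-R/2) (R/2), ψ (z + (x1, x2)) =
      ∫⁻ x2 in Ioo (-R/2) (R/2), ψ (z.1 + x1, x2) := fun x1 =>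
    setLIntegral_Ioo_periodic_add hR (f := fun t => ψ (z.1 + x1, t))
      (fun t => (hψ (z.1 + x1, t)).2) z.2
  simp only [h1]
  refine setLIntegral_Ioo_periodic_add hR
    (f := fun s => ∫⁻ x2 in Ioo (-R/2) (R/2), ψ (s, x2)) (fun s => ?_) z.1
  exact lintegral_congr fun t => (hψ (s, t)).1

/-- The periodic convolution estimate `‖κ ∗ ψ‖₁ = ‖κ‖₁ ‖ψ‖₁`. -/
theorem DoublyPeriodic.setLIntegral_lintegral_mul {R : ℝ} (hR : 0 < R) {ψ : ℝ × ℝ → ℝ≥0∞}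
    (hψ : DoublyPeriodic R ψ) (hm : Measurable ψ) {κ : ℝ × ℝ → ℝ≥0∞} (hκ : Measurable κ) :
    ∫⁻ x in KR R, ∫⁻ z, κ z * ψ (x + z) = (∫⁻ z, κ z) * ∫⁻ x in KR R, ψ x := by
  rw [lintegral_lintegral_swap (by fun_prop)]
  have : ∀ z, ∫⁻ x in KR R, κ z * ψ (x + z) = κ z * ∫⁻ x in KR R, ψ x := by
    intro z
    rw [lintegral_const_mul _ (by fun_prop)]
    simp_rw [add_comm _ z]
    rw [hψ.setLIntegral_add hR hm]
  simp_rw [this]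
  rw [lintegral_mul_const _ hκ]

/-- The product kernel `|z₁|⁻ˢ |z₂|⁻ˢ exp (-c |z|²)`. -/
noncomputable def singGauss (s c : ℝ) (z : ℝ × ℝ) : ℝ≥0∞ :=
  ENNReal.ofReal (|z.1| ^ (-s) * Real.exp (-c * z.1 ^ 2)) *
    ENNReal.ofReal (|z.2| ^ (-s) * Real.exp (-c * z.2 ^ 2))

theorem measurable_singGauss (s c : ℝ) : Measurable (singGauss s c) := by
  unfold singGauss
  fun_prop

theorem lintegral_singGauss_lt_top {s c : ℝ} (hs : s < 1) (hc : 0 < c) :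
    ∫⁻ z, singGauss s c z < ∞ := by
  have h1 : ∫⁻ t : ℝ, ENNReal.ofReal (|t| ^ (-s) * Real.exp (-c * t ^ 2)) < ∞ := by
    have hi : IntegrableOn (fun t : ℝ => |t| ^ (-s) * Real.exp (-c * t ^ 2)) (Ioi 0) := by
      refine (integrableOn_rpow_mul_exp_neg_mul_sq hc (s := -s) (by linarith)).congr_fun ?_
        measurableSet_Ioi
      intro t ht
      simp only [abs_of_pos (mem_Ioi.1 ht)]
    have hi' : Integrable (fun t : ℝ => |t| ^ (-s) * Real.exp (-c * t ^ 2)) := by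
      have hn : IntegrableOn (fun t : ℝ => |t| ^ (-s) * Real.exp (-c * t ^ 2)) (Iio 0) := by
        have := IntegrableOn.comp_neg_Iio (c := (0 : ℝ)) (by simpa using hi)
        simpa using this
      rw [← integrableOn_univ, ← Iio_union_Ici (a := (0 : ℝ))]
      exact hn.union ((integrableOn_Ici_iff_integrableOn_Ioi (by simp)).2 hi)
    rw [← ofReal_integral_eq_lintegral_ofReal hi' (ae_of_all _ fun t => by positivity)]
    exact ENNReal.ofReal_lt_top
  unfold singGauss
  rw [Measure.volume_eq_prod, lintegral_prod_mul
    (f := fun t : ℝ => ENNReal.ofReal (|t| ^ (-s) * Real.exp (-c * t ^ 2)))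
    (g := fun t : ℝ => ENNReal.ofReal (|t| ^ (-s) * Real.exp (-c * t ^ 2)))
    (by fun_prop) (by fun_prop)]
  exact ENNReal.mul_lt_top h1 h1

theorem singGauss_zero (c : ℝ) (z : ℝ × ℝ) :
    singGauss 0 c z = ENNReal.ofReal (Real.exp (-c * (z.1 ^ 2 + z.2 ^ 2))) := by
  simp only [singGauss, neg_zero, Real.rpow_zero, one_mul]
  rw [← ENNReal.ofReal_mul (by positivity), ← Real.exp_add]
  congr 2; ring

theorem singGauss_mul (s s' c c' : ℝ) {z : ℝ × ℝ} (h1 : z.1 ≠ 0) (h2 : z.2 ≠ 0) :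
    singGauss s c z * singGauss s' c' z = singGauss (s + s') (c + c') z := by
  have key : ∀ t : ℝ, t ≠ 0 → ENNReal.ofReal (|t| ^ (-s) * Real.exp (-c * t ^ 2)) *
      ENNReal.ofReal (|t| ^ (-s') * Real.exp (-c' * t ^ 2)) =
      ENNReal.ofReal (|t| ^ (-(s + s')) * Real.exp (-(c + c') * t ^ 2)) := by
    intro t ht
    rw [← ENNReal.ofReal_mul (by positivity), neg_add, Real.rpow_add (abs_pos.2 ht),
      neg_add, add_mul, Real.exp_add]
    congr 1; ring
  unfold singGauss
  rw [← key _ h1, ← key _ h2]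
  ring

/-- The Gaussian-weighted integral of a periodic function is bounded by its integral over a
period cell, uniformly in the period `R ≥ 2`. -/
theorem exists_gauss_le : ∃ C : ℝ≥0∞, C < ∞ ∧ ∀ R : ℝ, 2 ≤ R → ∀ ψ : ℝ × ℝ → ℝ≥0∞,
    DoublyPeriodic R ψ → Measurable ψ → ∀ x : ℝ × ℝ,
      ∫⁻ z, singGauss 0 (1/4) z * ψ (x + z) ≤ C * ∫⁻ y in KR R, ψ y := by
  have hI := lintegral_singGauss_lt_top (s := 0) (c := 1/8) (by norm_num) (by norm_num)
  refine ⟨4⁻¹ * (ENNReal.ofReal (Real.exp (1/2)) * ∫⁻ z, singGauss 0 (1/8) z),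
    ENNReal.mul_lt_top (by simp) (ENNReal.mul_lt_top ENNReal.ofReal_lt_top hI), ?_⟩
  intro R hR ψ hψ hm x
  have hmg := measurable_singGauss 0 (1/8)
  have hmg' := measurable_singGauss 0 (1/4)
  have hsub : KR 2 ⊆ KR R := by
    apply Set.prod_mono <;> exact Ioo_subset_Ioo (by linarith) (by linarith)
  have hvol : volume (KR 2) = 4 := by
    rw [volume_KR (by norm_num)]; norm_num
  have hg : ∀ s ∈ KR 2, ∀ z, singGauss 0 (1/4) z ≤
      ENNReal.ofReal (Real.exp (1/2)) * singGauss 0 (1/8) (z - s) := by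
    intro s hs z
    rw [singGauss_zero, singGauss_zero, ← ENNReal.ofReal_mul (by positivity), ← Real.exp_add]
    refine ENNReal.ofReal_le_ofReal (Real.exp_le_exp.2 ?_)
    obtain ⟨⟨h1, h2⟩, h3, h4⟩ := hs
    simp only [Prod.fst_sub, Prod.snd_sub]
    nlinarith [sq_nonneg (z.1 + s.1), sq_nonneg (z.2 + s.2), mul_self_nonneg (z.1 - s.1)]
  have h4 : 4 * ∫⁻ z, singGauss 0 (1/4) z * ψ (x + z) ≤
      ENNReal.ofReal (Real.exp (1/2)) * (∫⁻ z, singGauss 0 (1/8) z) * ∫⁻ y in KR R, ψ y := by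
    calc 4 * ∫⁻ z, singGauss 0 (1/4) z * ψ (x + z)
        = ∫⁻ _s in KR 2, ∫⁻ z, singGauss 0 (1/4) z * ψ (x + z) := by
          rw [setLIntegral_const, hvol, mul_comm]
      _ ≤ ∫⁻ s in KR 2, ∫⁻ z, ENNReal.ofReal (Real.exp (1/2)) * singGauss 0 (1/8) z
            * ψ (x + (z + s)) := by
          refine setLIntegral_mono' (measurableSet_KR 2) fun s hs => ?_
          rw [← lintegral_add_right_eq_self _ s]
          refine lintegral_mono fun z => ?_
          have := hg s hs (z + s)
          rw [add_sub_cancel_right] at this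
          gcongr
      _ = ∫⁻ z, ∫⁻ s in KR 2, ENNReal.ofReal (Real.exp (1/2)) * singGauss 0 (1/8) z
            * ψ (x + (z + s)) := lintegral_lintegral_swap (by fun_prop)
      _ ≤ ∫⁻ z, ENNReal.ofReal (Real.exp (1/2)) * singGauss 0 (1/8) z * ∫⁻ y in KR R, ψ y := by
          refine lintegral_mono fun z => ?_
          simp only
          rw [lintegral_const_mul _ (by fun_prop)]
          refine mul_le_mul_right ?_ _
          refine (lintegral_mono_set hsub).trans ?_
          simp_rw [← add_assoc]
          rw [hψ.setLIntegral_add (by linarith) hm]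
      _ = _ := by
          rw [lintegral_mul_const _ (by fun_prop), lintegral_const_mul _ hmg]
  rw [mul_assoc, ← ENNReal.mul_le_iff_le_inv (by norm_num) (by norm_num)]
  exact h4

theorem lintegral_mul_sq_le {α : Type*} [MeasurableSpace α] (μ : Measure α) {f g : α → ℝ≥0∞}
    (hf : Measurable f) (hg : Measurable g) :
    (∫⁻ a, f a * g a ∂μ) ^ 2 ≤ (∫⁻ a, f a ^ 2 ∂μ) * ∫⁻ a, g a ^ 2 ∂μ := by
  have h := ENNReal.lintegral_mul_le_Lp_mul_Lq μ (p := 2) (q := 2)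
    (Real.HolderConjugate.two_two) hf.aemeasurable hg.aemeasurable
  have h2 := pow_le_pow_left₀ (zero_le) h 2
  refine h2.trans_eq ?_
  rw [mul_pow]
  simp only [← ENNReal.rpow_natCast, ← ENNReal.rpow_mul]
  norm_num

theorem ae_ne_zero_and_ne_zero : ∀ᵐ z : ℝ × ℝ, z.1 ≠ 0 ∧ z.2 ≠ 0 := by
  have h : ∀ᵐ t : ℝ, t ≠ 0 := by simp [ae_iff, measure_singleton]
  exact (Measure.quasiMeasurePreserving_fst.ae h).and (Measure.quasiMeasurePreserving_snd.ae h)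

theorem lintegral_singGauss_mul_sq_le (s s' c c' : ℝ) {f g : ℝ × ℝ → ℝ≥0∞} (hf : Measurable f)
    (hg : Measurable g) :
    (∫⁻ z, singGauss (s + s') (c + c') z * (f z * g z)) ^ 2 ≤
      (∫⁻ z, singGauss (s + s) (c + c) z * f z ^ 2) *
        ∫⁻ z, singGauss (s' + s') (c' + c') z * g z ^ 2 := by
  have h := lintegral_mul_sq_le volume ((measurable_singGauss s c).mul hf)
    ((measurable_singGauss s' c').mul hg)
  refine (Eq.trans_le ?_ h).trans_eq ?_
  · congr 1
    refine lintegral_congr_ae ?_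
    filter_upwards [ae_ne_zero_and_ne_zero] with z hz
    rw [← singGauss_mul s s' c c' hz.1 hz.2]
    simp only [Pi.mul_apply]
    ring
  · congr 1
    · refine lintegral_congr_ae ?_
      filter_upwards [ae_ne_zero_and_ne_zero] with z hz
      rw [← singGauss_mul s s c c hz.1 hz.2]
      simp only [Pi.mul_apply]
      ring
    · refine lintegral_congr_ae ?_
      filter_upwards [ae_ne_zero_and_ne_zero] with z hz
      rw [← singGauss_mul s' s' c' c' hz.1 hz.2]
      simp only [Pi.mul_apply]
      ring

/-- `L² → L²` and `L² → L⁴` bounds on a period cell for the convolution with the kernel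
`|z₁ z₂|^(-1/2) exp (-|z|² / 4)`, uniformly in the period `R ≥ 2`. -/
theorem exists_convolution_bounds : ∃ C : ℝ≥0∞, C < ∞ ∧ ∀ R : ℝ, 2 ≤ R → ∀ φ W : ℝ × ℝ → ℝ≥0∞,
    DoublyPeriodic R φ → Measurable φ →
    (∀ x, W x ≤ ∫⁻ z, singGauss (1/2) (1/4) z * φ (x + z)) →
    ∫⁻ x in KR R, W x ^ 2 ≤ C * ∫⁻ x in KR R, φ x ^ 2 ∧
    ∫⁻ x in KR R, W x ^ 4 ≤ C * (∫⁻ x in KR R, φ x ^ 2) ^ 2 := by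
  obtain ⟨C, hC, hgauss⟩ := exists_gauss_le
  have hA := lintegral_singGauss_lt_top (s := 3/4) (c := 1/4) (by norm_num) (by norm_num)
  have hB := lintegral_singGauss_lt_top (s := 1/4) (c := 1/4) (by norm_num) (by norm_num)
  have hD := lintegral_singGauss_lt_top (s := 1/2) (c := 1/4) (by norm_num) (by norm_num)
  set A := ∫⁻ z, singGauss (3/4) (1/4) z
  set B := ∫⁻ z, singGauss (1/4) (1/4) z with hBdef
  set D := ∫⁻ z, singGauss (1/2) (1/4) z with hDdef
  refine ⟨B * A + D * (C * A ^ 2), ENNReal.add_lt_top.2 ⟨ENNReal.mul_lt_top hB hA,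
    ENNReal.mul_lt_top hD (ENNReal.mul_lt_top hC (ENNReal.pow_lt_top hA))⟩, ?_⟩
  intro R hR φ W hφ hm hW
  have hR0 : 0 < R := by linarith
  have hψ : DoublyPeriodic R (fun x => φ x ^ 2) := hφ.comp (· ^ 2)
  have hψm : Measurable (fun x => φ x ^ 2) := by fun_prop
  set Ψ := ∫⁻ x in KR R, φ x ^ 2
  have h2 : ∀ x, W x ^ 2 ≤ (∫⁻ z, singGauss (1/4) (1/4) z * φ (x + z) ^ 2) * A := by
    intro x
    refine (pow_le_pow_left₀ zero_le (hW x) 2).trans ?_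
    have := lintegral_singGauss_mul_sq_le (1/8) (3/8) (1/8) (1/8) (f := fun z => φ (x + z))
      (g := fun _ => 1) (by fun_prop) (by fun_prop)
    norm_num at this
    norm_num
    exact this
  have h4 : ∀ x, W x ^ 4 ≤ (∫⁻ z, singGauss (1/2) (1/4) z * φ (x + z) ^ 2) * (C * Ψ * A ^ 2) := by
    intro x
    have h := lintegral_singGauss_mul_sq_le (1/4) 0 (1/8) (1/8) (f := fun z => φ (x + z))
      (g := fun z => φ (x + z)) (by fun_prop) (by fun_prop)
    norm_num [← sq] at h
    calc W x ^ 4 = (W x ^ 2) ^ 2 := by ring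
      _ ≤ ((∫⁻ z, singGauss (1/4) (1/4) z * φ (x + z) ^ 2) * A) ^ 2 :=
          pow_le_pow_left₀ zero_le (h2 x) 2
      _ = (∫⁻ z, singGauss (1/4) (1/4) z * φ (x + z) ^ 2) ^ 2 * A ^ 2 := by ring
      _ ≤ ((∫⁻ z, singGauss (1/2) (1/4) z * φ (x + z) ^ 2) *
            ∫⁻ z, singGauss 0 (1/4) z * φ (x + z) ^ 2) * A ^ 2 := by
          gcongr
      _ ≤ ((∫⁻ z, singGauss (1/2) (1/4) z * φ (x + z) ^ 2) * (C * Ψ)) * A ^ 2 := by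
          gcongr
          exact hgauss R hR _ hψ hψm x
      _ = _ := by ring
  have hsg1 := measurable_singGauss (1/4) (1/4)
  have hsg2 := measurable_singGauss (1/2) (1/4)
  constructor
  · calc ∫⁻ x in KR R, W x ^ 2
        ≤ ∫⁻ x in KR R, (∫⁻ z, singGauss (1/4) (1/4) z * φ (x + z) ^ 2) * A := lintegral_mono h2
      _ = B * A * Ψ := by
          rw [lintegral_mul_const' _ _ hA.ne, hψ.setLIntegral_lintegral_mul hR0 hψm hsg1]
          ring
      _ ≤ _ := by gcongr; exact le_self_add
  · calc ∫⁻ x in KR R, W x ^ 4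
        ≤ ∫⁻ x in KR R, (∫⁻ z, singGauss (1/2) (1/4) z * φ (x + z) ^ 2) * (C * Ψ * A ^ 2) :=
          lintegral_mono h4
      _ = D * (C * A ^ 2) * Ψ ^ 2 := by
          rw [lintegral_mul_const _ (by fun_prop), hψ.setLIntegral_lintegral_mul hR0 hψm hsg2]
          ring
      _ ≤ _ := by gcongr; exact le_add_self

/-- The point with polar coordinates `(r, θ)`. -/
noncomputable def polarPt (r θ : ℝ) : ℝ × ℝ := (r * Real.cos θ, r * Real.sin θ)

theorem continuous_polarPt : Continuous (fun p : ℝ × ℝ => polarPt p.1 p.2) := by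
  unfold polarPt
  fun_prop

theorem sq_add_sq_polarPt (r θ : ℝ) : (polarPt r θ).1 ^ 2 + (polarPt r θ).2 ^ 2 = r ^ 2 := by
  simp only [polarPt]
  linear_combination r ^ 2 * Real.cos_sq_add_sin_sq θ

theorem hasDerivAt_comp_polarPt_left {U : ℝ × ℝ → ℂ} (hU : Differentiable ℝ U) (r θ : ℝ) :
    HasDerivAt (fun s => U (polarPt s θ))
      (fderiv ℝ U (polarPt r θ) (Real.cos θ, Real.sin θ)) r := by
  have h : HasDerivAt (fun s => polarPt s θ) (Real.cos θ, Real.sin θ) r := by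
    have h1 := (hasDerivAt_id r).mul_const (Real.cos θ)
    have h2 := (hasDerivAt_id r).mul_const (Real.sin θ)
    simpa [polarPt] using h1.prodMk h2
  exact (hU _).hasFDerivAt.comp_hasDerivAt r h

theorem hasDerivAt_comp_polarPt_right {U : ℝ × ℝ → ℂ} (hU : Differentiable ℝ U) (r θ : ℝ) :
    HasDerivAt (fun t => U (polarPt r t))
      (fderiv ℝ U (polarPt r θ) (r * -Real.sin θ, r * Real.cos θ)) θ := by
  have h : HasDerivAt (fun t => polarPt r t) (r * -Real.sin θ, r * Real.cos θ) θ :=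
    ((Real.hasDerivAt_cos θ).const_mul r).prodMk ((Real.hasDerivAt_sin θ).const_mul r)
  exact (hU _).hasFDerivAt.comp_hasDerivAt θ h

theorem fderiv_apply_eq (U : ℝ × ℝ → ℂ) (z : ℝ × ℝ) (a b : ℝ) :
    fderiv ℝ U z (a, b) = a * fderiv ℝ U z (1, 0) + b * fderiv ℝ U z (0, 1) := by
  have : ((a, b) : ℝ × ℝ) = a • ((1, 0) : ℝ × ℝ) + b • ((0, 1) : ℝ × ℝ) := by simp
  rw [this, map_add, map_smul, map_smul, Complex.real_smul, Complex.real_smul]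

/-- The integral of `U` over angles at radius `r`. -/
noncomputable def angInt (U : ℝ × ℝ → ℂ) (r : ℝ) : ℂ :=
  ∫ θ in -Real.pi..Real.pi, U (polarPt r θ)

/-- The first angular Fourier coefficient of `V` at radius `r`. -/
noncomputable def angIntExp (V : ℝ × ℝ → ℂ) (r : ℝ) : ℂ :=
  ∫ θ in -Real.pi..Real.pi, Complex.exp (-(Complex.I * θ)) * V (polarPt r θ)

theorem continuous_angInt {U : ℝ × ℝ → ℂ} (hU : Continuous U) : Continuous (angInt U) :=
  intervalIntegral.continuous_parametric_intervalIntegral_of_continuous'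
    (f := fun r θ => U (polarPt r θ)) (hU.comp continuous_polarPt) _ _

theorem continuous_angIntExp {V : ℝ × ℝ → ℂ} (hV : Continuous V) : Continuous (angIntExp V) := by
  refine intervalIntegral.continuous_parametric_intervalIntegral_of_continuous' ?_ _ _
  have h : Continuous (fun p : ℝ × ℝ => V (polarPt p.1 p.2)) := hV.comp continuous_polarPt
  exact (by fun_prop : Continuous fun p : ℝ × ℝ => Complex.exp (-(Complex.I * p.2))).mul h

theorem norm_angInt_le {U : ℝ × ℝ → ℂ} {M : ℝ} (hM : ∀ z, ‖U z‖ ≤ M) (r : ℝ) :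
    ‖angInt U r‖ ≤ M * (2 * Real.pi) := by
  refine (intervalIntegral.norm_integral_le_of_norm_le_const (C := M) fun θ _ => hM _).trans_eq ?_
  rw [abs_of_pos (by linarith [Real.pi_pos])]
  ring

theorem norm_exp_neg_I_mul (θ : ℝ) : ‖Complex.exp (-(Complex.I * θ))‖ = 1 := by
  rw [Complex.norm_exp]; simp

theorem norm_angIntExp_le {V : ℝ × ℝ → ℂ} {M : ℝ} (hM : ∀ z, ‖V z‖ ≤ M) (r : ℝ) :
    ‖angIntExp V r‖ ≤ M * (2 * Real.pi) := by
  refine (intervalIntegral.norm_integral_le_of_norm_le_const (C := M) fun θ _ => ?_).trans_eq ?_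
  · rw [norm_mul, norm_exp_neg_I_mul, one_mul]
    exact hM _
  · rw [abs_of_pos (by linarith [Real.pi_pos])]
    ring

theorem hasDerivAt_angInt {U : ℝ × ℝ → ℂ} (hU : ContDiff ℝ 1 U) {r : ℝ} (hr : r ≠ 0) :
    HasDerivAt (angInt U) (angIntExp (aOp U) r - r / 2 * angInt U r) r := by
  have hd : Differentiable ℝ U := hU.differentiable (by norm_num)
  have hc : Continuous (fun z => fderiv ℝ U z) := hU.continuous_fderiv (by norm_num)
  have hUc := hU.continuous
  have hpp := continuous_polarPt
  have hF' : Continuous (fun p : ℝ × ℝ =>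
      fderiv ℝ U (polarPt p.1 p.2) (Real.cos p.2, Real.sin p.2)) :=
    (hc.comp hpp).clm_apply (by fun_prop)
  obtain ⟨M, hM⟩ := ((isCompact_closedBall r 1).prod
    (isCompact_Icc (a := -Real.pi) (b := Real.pi))).exists_bound_of_continuousOn hF'.continuousOn
  have hpi : -Real.pi ≤ Real.pi := by linarith [Real.pi_pos]
  have h1 := (intervalIntegral.hasDerivAt_integral_of_dominated_loc_of_deriv_le
    (μ := volume) (a := -Real.pi) (b := Real.pi)
    (F := fun s θ => U (polarPt s θ)) (x₀ := r) (bound := fun _ => M)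
    (F' := fun s θ => fderiv ℝ U (polarPt s θ) (Real.cos θ, Real.sin θ))
    (Metric.closedBall_mem_nhds r one_pos)
    (Eventually.of_forall fun s =>
      (hUc.comp (hpp.comp (by fun_prop : Continuous fun θ : ℝ => (s, θ)))).aestronglyMeasurable)
    ((hUc.comp (hpp.comp (by fun_prop : Continuous fun θ : ℝ => (r, θ)))).intervalIntegrable _ _)
    (hF'.comp (by fun_prop : Continuous fun θ : ℝ => (r, θ))).aestronglyMeasurable
    (ae_of_all _ fun θ hθ s hs => by
      rw [uIoc_of_le hpi] at hθ
      exact hM (s, θ) ⟨hs, Ioc_subset_Icc_self hθ⟩)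
    (by simp)
    (ae_of_all _ fun θ _ s _ => hasDerivAt_comp_polarPt_left hd s θ)).2
  have hg : Continuous (fun θ : ℝ =>
      fderiv ℝ U (polarPt r θ) (r * -Real.sin θ, r * Real.cos θ)) :=
    (hc.comp (hpp.comp (by fun_prop : Continuous fun θ : ℝ => (r, θ)))).clm_apply (by fun_prop)
  have h2 : ∫ θ in -Real.pi..Real.pi,
      fderiv ℝ U (polarPt r θ) (r * -Real.sin θ, r * Real.cos θ) = 0 := by
    rw [intervalIntegral.integral_eq_sub_of_hasDerivAt
      (fun θ _ => hasDerivAt_comp_polarPt_right hd r θ) (hg.intervalIntegrable _ _)]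
    simp [polarPt]
  have h3 : angIntExp (aOp U) r = (∫ θ in -Real.pi..Real.pi,
      fderiv ℝ U (polarPt r θ) (Real.cos θ, Real.sin θ)) + Complex.I / r *
      (∫ θ in -Real.pi..Real.pi, fderiv ℝ U (polarPt r θ) (r * -Real.sin θ, r * Real.cos θ))
      + r / 2 * angInt U r := by
    have i1 : IntervalIntegrable (fun θ : ℝ =>
        fderiv ℝ U (polarPt r θ) (Real.cos θ, Real.sin θ)) volume (-Real.pi) Real.pi :=
      (hF'.comp (by fun_prop : Continuous fun θ : ℝ => (r, θ))).intervalIntegrable _ _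
    have i2 : IntervalIntegrable (fun θ : ℝ => Complex.I / r *
        fderiv ℝ U (polarPt r θ) (r * -Real.sin θ, r * Real.cos θ)) volume (-Real.pi) Real.pi :=
      (continuous_const.mul hg).intervalIntegrable _ _
    have i3 : IntervalIntegrable (fun θ : ℝ => (r / 2 : ℂ) * U (polarPt r θ))
        volume (-Real.pi) Real.pi :=
      (continuous_const.mul (hUc.comp (hpp.comp
        (by fun_prop : Continuous fun θ : ℝ => (r, θ))))).intervalIntegrable _ _
    rw [angInt, ← intervalIntegral.integral_const_mul, ← intervalIntegral.integral_const_mul,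
      ← intervalIntegral.integral_add i1 i2, ← intervalIntegral.integral_add (i1.add i2) i3]
    refine intervalIntegral.integral_congr fun θ _ => ?_
    rw [aOp_eq, fderiv_apply_eq U _ (Real.cos θ) (Real.sin θ),
      fderiv_apply_eq U _ (r * -Real.sin θ) (r * Real.cos θ)]
    have hr' : (r : ℂ) ≠ 0 := by exact_mod_cast hr
    have e1 : Complex.exp (-(Complex.I * θ)) = Complex.cos θ - Complex.sin θ * Complex.I := by
      rw [show -(Complex.I * (θ : ℂ)) = (-θ : ℂ) * Complex.I by ring, Complex.exp_mul_I,
        Complex.cos_neg, Complex.sin_neg]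
      ring
    rw [e1]
    simp only [polarPt]
    push_cast
    field_simp
    have hcs := Complex.cos_sq_add_sin_sq (θ : ℂ)
    generalize fderiv ℝ U (r * Real.cos θ, r * Real.sin θ) (1, 0) = p1
    generalize fderiv ℝ U (r * Real.cos θ, r * Real.sin θ) (0, 1) = p2
    generalize U (r * Real.cos θ, r * Real.sin θ) = u
    linear_combination (-2 * Complex.sin θ * p2 - r * u * Complex.sin θ ^ 2) * Complex.I_sq
      + r * u * hcs
  have h4 : angIntExp (aOp U) r - r / 2 * angInt U r = ∫ θ in -Real.pi..Real.pi,
      fderiv ℝ U (polarPt r θ) (Real.cos θ, Real.sin θ) := by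
    rw [h3, h2]
    ring
  rw [h4]
  exact h1

theorem integrableOn_one_add_mul_exp (M : ℝ) :
    IntegrableOn (fun r : ℝ => M * ((1 + r) * Real.exp (-(1/4) * r ^ 2))) (Ioi 0) := by
  have h1 := (integrable_exp_neg_mul_sq (b := 1/4) (by norm_num)).integrableOn (s := Ioi 0)
  have h2 := (integrable_mul_exp_neg_mul_sq (b := 1/4) (by norm_num)).integrableOn (s := Ioi 0)
  refine IntegrableOn.congr_fun ((h1.add h2).const_mul M) (fun r _ => ?_) measurableSet_Ioi
  simp only [Pi.add_apply]
  ring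

theorem angInt_zero (U : ℝ × ℝ → ℂ) : angInt U 0 = 2 * Real.pi * U 0 := by
  simp only [angInt, polarPt, zero_mul, intervalIntegral.integral_const]
  rw [Complex.real_smul]
  push_cast
  simp only [Prod.mk_zero_zero]
  ring

theorem integral_radial {U : ℝ × ℝ → ℂ} (hU : ContDiff ℝ 1 U) {M : ℝ} (hM : ∀ z, ‖U z‖ ≤ M)
    (hM' : ∀ z, ‖aOp U z‖ ≤ M) (ha : Continuous (aOp U)) :
    2 * Real.pi * U 0 = (∫ r in Ioi (0 : ℝ), r * Real.exp (-(1/4) * r ^ 2) * angInt U r) -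
      ∫ r in Ioi (0 : ℝ), Real.exp (-(1/4) * r ^ 2) * angIntExp (aOp U) r := by
  have hm := continuous_angInt hU.continuous
  have hq := continuous_angIntExp ha
  have hM0 : 0 ≤ M := (norm_nonneg _).trans (hM 0)
  have hpi := Real.pi_pos
  have i1 : IntegrableOn (fun r : ℝ => (r * Real.exp (-(1/4) * r ^ 2) * angInt U r : ℂ))
      (Ioi 0) := by
    refine Integrable.mono' (integrableOn_one_add_mul_exp (M * (2 * Real.pi)))
      (by fun_prop) ?_
    filter_upwards [ae_restrict_mem measurableSet_Ioi] with r hr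
    have hr' : 0 < r := hr
    rw [norm_mul, norm_mul, Complex.norm_real, Complex.norm_real, Real.norm_of_nonneg hr'.le,
      Real.norm_of_nonneg (Real.exp_pos _).le, mul_comm]
    exact mul_le_mul (norm_angInt_le hM r) (by gcongr; linarith) (by positivity) (by positivity)
  have i2 : IntegrableOn (fun r : ℝ => (Real.exp (-(1/4) * r ^ 2) * angIntExp (aOp U) r : ℂ))
      (Ioi 0) := by
    refine Integrable.mono' (integrableOn_one_add_mul_exp (M * (2 * Real.pi)))
      (by fun_prop) ?_
    filter_upwards [ae_restrict_mem measurableSet_Ioi] with r hr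
    have hr' : 0 < r := hr
    rw [norm_mul, Complex.norm_real, Real.norm_of_nonneg (Real.exp_pos _).le, mul_comm]
    refine mul_le_mul (norm_angIntExp_le hM' r) ?_ (by positivity) (by positivity)
    exact le_mul_of_one_le_left (Real.exp_pos _).le (by linarith)
  have hderiv : ∀ r ∈ Ioi (0 : ℝ), HasDerivAt
      (fun r : ℝ => (Real.exp (-(1/4) * r ^ 2) * angInt U r : ℂ))
      (Real.exp (-(1/4) * r ^ 2) * angIntExp (aOp U) r
        - r * Real.exp (-(1/4) * r ^ 2) * angInt U r) r := by
    intro r hr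
    have h1 : HasDerivAt (fun r : ℝ => Real.exp (-(1/4) * r ^ 2))
        (Real.exp (-(1/4) * r ^ 2) * (-(1/4) * (2 * r))) r := by
      simpa only [Nat.cast_ofNat, Nat.add_one_sub_one, pow_one] using
        ((hasDerivAt_pow 2 r).const_mul (-(1/4))).exp
    have h2 := h1.ofReal_comp.mul (hasDerivAt_angInt hU (ne_of_gt hr))
    refine h2.congr_deriv ?_
    push_cast
    ring
  have htend : Tendsto (fun r : ℝ => (Real.exp (-(1/4) * r ^ 2) * angInt U r : ℂ)) atTop
      (𝓝 0) := by
    have h0 : Tendsto (fun r : ℝ => Real.exp (-(1/4) * r ^ 2)) atTop (𝓝 0) := by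
      refine Real.tendsto_exp_atBot.comp ?_
      exact (tendsto_pow_atTop (by norm_num)).const_mul_atTop_of_neg (by norm_num)
    refine squeeze_zero_norm (a := fun r => Real.exp (-(1/4) * r ^ 2) * (M * (2 * Real.pi)))
      (fun r => ?_) (by simpa using h0.mul_const (M * (2 * Real.pi)))
    rw [norm_mul, Complex.norm_real, Real.norm_of_nonneg (Real.exp_pos _).le]
    gcongr
    exact norm_angInt_le hM r
  have key := integral_Ioi_of_hasDerivAt_of_tendsto (a := (0 : ℝ))
    (Continuous.continuousWithinAt (by fun_prop)) hderiv (i2.sub i1) htend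
  rw [integral_sub i2 i1, angInt_zero] at key
  simp only [ne_eq, OfNat.ofNat_ne_zero, not_false_eq_true, zero_pow, mul_zero, Real.exp_zero,
    Complex.ofReal_one, one_mul, zero_sub] at key
  linear_combination key

theorem integral_gauss_eq_radial {U : ℝ × ℝ → ℂ} (hU : Continuous U) {M : ℝ}
    (hM : ∀ z, ‖U z‖ ≤ M) :
    ∫ z : ℝ × ℝ, (Real.exp (-(1/4) * (z.1 ^ 2 + z.2 ^ 2)) : ℂ) * U z =
      ∫ r in Ioi (0 : ℝ), r * Real.exp (-(1/4) * r ^ 2) * angInt U r := by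
  have hpi := Real.pi_pos
  rw [← integral_comp_polarCoord_symm]
  have e1 : ∀ p : ℝ × ℝ, polarCoord.symm p = polarPt p.1 p.2 := fun p => rfl
  simp only [e1, sq_add_sq_polarPt, Complex.real_smul]
  have hc : Continuous (fun p : ℝ × ℝ => U (polarPt p.1 p.2)) := hU.comp continuous_polarPt
  have hi : IntegrableOn (fun p : ℝ × ℝ =>
      (p.1 : ℂ) * ((Real.exp (-(1/4) * p.1 ^ 2) : ℂ) * U (polarPt p.1 p.2)))
      (Ioi 0 ×ˢ Ioo (-Real.pi) Real.pi) (volume.prod volume) := by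
    have hb : Integrable (fun p : ℝ × ℝ => M * ((1 + p.1) * Real.exp (-(1/4) * p.1 ^ 2)) * 1)
        ((volume.restrict (Ioi 0)).prod (volume.restrict (Ioo (-Real.pi) Real.pi))) :=
      (integrableOn_one_add_mul_exp M).mul_prod (integrable_const (1 : ℝ))
    rw [Measure.prod_restrict] at hb
    have hc' : Continuous (fun p : ℝ × ℝ =>
        (p.1 : ℂ) * ((Real.exp (-(1/4) * p.1 ^ 2) : ℂ) * U (polarPt p.1 p.2))) :=
      Continuous.mul (by fun_prop) (Continuous.mul (by fun_prop) hc)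
    refine Integrable.mono' hb hc'.aestronglyMeasurable ?_
    filter_upwards [ae_restrict_mem (measurableSet_Ioi.prod measurableSet_Ioo)] with p hp
    have hp1 : 0 < p.1 := hp.1
    rw [norm_mul, norm_mul, Complex.norm_real, Complex.norm_real, Real.norm_of_nonneg hp1.le,
      Real.norm_of_nonneg (Real.exp_pos _).le, mul_one, ← mul_assoc, mul_comm]
    exact mul_le_mul (hM _) (by gcongr; linarith) (by positivity) ((norm_nonneg _).trans (hM 0))
  rw [polarCoord_target, Measure.volume_eq_prod, setIntegral_prod _ hi]
  refine integral_congr_ae (ae_of_all _ fun r => ?_)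
  simp only
  rw [angInt, intervalIntegral.integral_of_le (by linarith), integral_Ioc_eq_integral_Ioo,
    ← integral_const_mul]
  refine integral_congr_ae (ae_of_all _ fun θ => ?_)
  ring

theorem inv_sqrt_mul_exp_le_singGauss {z : ℝ × ℝ} (h1 : z.1 ≠ 0) (h2 : z.2 ≠ 0) :
    ENNReal.ofReal ((Real.sqrt (z.1 ^ 2 + z.2 ^ 2))⁻¹ * Real.exp (-(1/4) * (z.1 ^ 2 + z.2 ^ 2))) ≤
      singGauss (1/2) (1/4) z := by
  have a1 := abs_pos.2 h1
  have a2 := abs_pos.2 h2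
  rw [singGauss, ← ENNReal.ofReal_mul (by positivity)]
  refine ENNReal.ofReal_le_ofReal ?_
  have e1 : |z.1| ^ (-(1/2) : ℝ) * |z.2| ^ (-(1/2) : ℝ) = (Real.sqrt (|z.1| * |z.2|))⁻¹ := by
    rw [← Real.mul_rpow a1.le a2.le, Real.rpow_neg (by positivity), Real.sqrt_eq_rpow]
  have e2 : |z.1| ^ (-(1/2) : ℝ) * Real.exp (-(1/4) * z.1 ^ 2) *
      (|z.2| ^ (-(1/2) : ℝ) * Real.exp (-(1/4) * z.2 ^ 2)) =
      (Real.sqrt (|z.1| * |z.2|))⁻¹ * Real.exp (-(1/4) * (z.1 ^ 2 + z.2 ^ 2)) := by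
    rw [← e1, mul_add, Real.exp_add]
    ring
  rw [e2]
  gcongr
  nlinarith [sq_abs z.1, sq_abs z.2, sq_nonneg (|z.1| - |z.2|)]

theorem enorm_angIntExp_le (V : ℝ × ℝ → ℂ) (r : ℝ) :
    ‖angIntExp V r‖ₑ ≤ ∫⁻ θ in Ioo (-Real.pi) Real.pi, ‖V (polarPt r θ)‖ₑ := by
  rw [angIntExp, intervalIntegral.integral_of_le (by linarith [Real.pi_pos]),
    integral_Ioc_eq_integral_Ioo]
  refine (enorm_integral_le_lintegral_enorm _).trans (lintegral_mono fun θ => ?_)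
  rw [enorm_mul, ← ofReal_norm, norm_exp_neg_I_mul, ENNReal.ofReal_one, one_mul]

theorem lintegral_radial_eq {V : ℝ × ℝ → ℂ} (hV : Continuous V) :
    ∫⁻ r in Ioi (0 : ℝ), ∫⁻ θ in Ioo (-Real.pi) Real.pi,
      ENNReal.ofReal (Real.exp (-(1/4) * r ^ 2)) * ‖V (polarPt r θ)‖ₑ =
    ∫⁻ z : ℝ × ℝ, ENNReal.ofReal ((Real.sqrt (z.1 ^ 2 + z.2 ^ 2))⁻¹ *
      Real.exp (-(1/4) * (z.1 ^ 2 + z.2 ^ 2))) * ‖V z‖ₑ := by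
  have hc : Continuous (fun p : ℝ × ℝ => V (polarPt p.1 p.2)) := hV.comp continuous_polarPt
  have hm : Measurable (fun p : ℝ × ℝ =>
      ENNReal.ofReal (Real.exp (-(1/4) * p.1 ^ 2)) * ‖V (polarPt p.1 p.2)‖ₑ) :=
    Measurable.mul (by fun_prop) hc.measurable.enorm
  rw [← lintegral_comp_polarCoord_symm, ← lintegral_prod (fun p : ℝ × ℝ =>
      ENNReal.ofReal (Real.exp (-(1/4) * p.1 ^ 2)) * ‖V (polarPt p.1 p.2)‖ₑ) hm.aemeasurable,
    Measure.prod_restrict, ← Measure.volume_eq_prod, ← polarCoord_target]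
  refine setLIntegral_congr_fun polarCoord.open_target.measurableSet fun p hp => ?_
  have hp1 : 0 < p.1 := by
    rw [polarCoord_target] at hp
    exact hp.1
  have e1 : polarCoord.symm p = polarPt p.1 p.2 := rfl
  simp only [e1, sq_add_sq_polarPt, smul_eq_mul, Real.sqrt_sq hp1.le]
  rw [← mul_assoc, ← ENNReal.ofReal_mul hp1.le, mul_inv_cancel_left₀ hp1.ne']

theorem enorm_integral_radial_le {V : ℝ × ℝ → ℂ} (hV : Continuous V) :
    ‖∫ r in Ioi (0 : ℝ), (Real.exp (-(1/4) * r ^ 2) : ℂ) * angIntExp V r‖ₑ ≤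
      ∫⁻ z, singGauss (1/2) (1/4) z * ‖V z‖ₑ := by
  have hc : Continuous (fun p : ℝ × ℝ => V (polarPt p.1 p.2)) := hV.comp continuous_polarPt
  calc ‖∫ r in Ioi (0 : ℝ), (Real.exp (-(1/4) * r ^ 2) : ℂ) * angIntExp V r‖ₑ
      ≤ ∫⁻ r in Ioi (0 : ℝ), ‖(Real.exp (-(1/4) * r ^ 2) : ℂ) * angIntExp V r‖ₑ :=
        enorm_integral_le_lintegral_enorm _
    _ ≤ ∫⁻ r in Ioi (0 : ℝ), ∫⁻ θ in Ioo (-Real.pi) Real.pi,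
          ENNReal.ofReal (Real.exp (-(1/4) * r ^ 2)) * ‖V (polarPt r θ)‖ₑ := by
        refine lintegral_mono fun r => ?_
        rw [enorm_mul, lintegral_const_mul (f := fun θ => ‖V (polarPt r θ)‖ₑ) _
          (hc.comp (by fun_prop : Continuous fun θ : ℝ => (r, θ))).measurable.enorm]
        refine mul_le_mul' ?_ (enorm_angIntExp_le V r)
        rw [← ofReal_norm, Complex.norm_real, Real.norm_of_nonneg (Real.exp_pos _).le]
    _ = _ := lintegral_radial_eq hV
    _ ≤ ∫⁻ z, singGauss (1/2) (1/4) z * ‖V z‖ₑ := by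
        refine lintegral_mono_ae ?_
        filter_upwards [ae_ne_zero_and_ne_zero] with z hz
        gcongr
        exact inv_sqrt_mul_exp_le_singGauss hz.1 hz.2

/-- Weighted Cauchy–Pompeiu estimate: the distance from `U 0` to the Gaussian average of `U`
is controlled by `aOp U`. -/
theorem enorm_sub_gauss_le {U : ℝ × ℝ → ℂ} (hU : ContDiff ℝ 1 U) {M : ℝ} (hM : ∀ z, ‖U z‖ ≤ M)
    (hM' : ∀ z, ‖aOp U z‖ ≤ M) (ha : Continuous (aOp U)) :
    ‖U 0 - 1 / (2 * Real.pi) *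
        ∫ z : ℝ × ℝ, (Real.exp (-(1/4) * (z.1 ^ 2 + z.2 ^ 2)) : ℂ) * U z‖ₑ ≤
      ∫⁻ z, singGauss (1/2) (1/4) z * ‖aOp U z‖ₑ := by
  refine le_trans ?_ (enorm_integral_radial_le ha)
  have h := integral_radial hU hM hM' ha
  have hpi : (Real.pi : ℂ) ≠ 0 := by exact_mod_cast Real.pi_ne_zero
  have e : U 0 - 1 / (2 * Real.pi) *
      ∫ z : ℝ × ℝ, (Real.exp (-(1/4) * (z.1 ^ 2 + z.2 ^ 2)) : ℂ) * U z =
      -(1 / (2 * Real.pi)) *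
        ∫ r in Ioi (0 : ℝ), Real.exp (-(1/4) * r ^ 2) * angIntExp (aOp U) r := by
    rw [integral_gauss_eq_radial hU.continuous hM]
    generalize (∫ r in Ioi (0 : ℝ), r * Real.exp (-(1/4) * r ^ 2) * angInt U r : ℂ) = I₁ at h ⊢
    generalize (∫ r in Ioi (0 : ℝ), Real.exp (-(1/4) * r ^ 2) * angIntExp (aOp U) r : ℂ) = I₂
      at h ⊢
    field_simp
    linear_combination h
  rw [e, ← ofReal_norm, ← ofReal_norm]
  refine ENNReal.ofReal_le_ofReal ?_
  rw [norm_mul]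
  refine mul_le_of_le_one_left (norm_nonneg _) ?_
  rw [norm_neg, norm_div, norm_one, norm_mul, Complex.norm_real,
    Real.norm_of_nonneg Real.pi_pos.le, div_le_one (by norm_num; exact Real.pi_pos)]
  norm_num
  linarith [Real.pi_gt_three]

theorem magPhase_add_left (p q z : ℝ × ℝ) :
    magPhase (p + q) z = magPhase p z * magPhase q z := by
  simp only [magPhase, ← Complex.exp_add, Prod.fst_add, Prod.snd_add]
  congr 1
  push_cast
  ring

theorem magPhase_add_right (p z w : ℝ × ℝ) :
    magPhase p (z + w) = magPhase p z * magPhase p w := by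
  simp only [magPhase, ← Complex.exp_add, Prod.fst_add, Prod.snd_add]
  congr 1
  push_cast
  ring

/-- The orthogonal projection onto the lowest Landau level, as a Gaussian average. -/
noncomputable def landauProj (u : ℝ × ℝ → ℂ) (x : ℝ × ℝ) : ℂ :=
  1 / (2 * Real.pi) *
    ∫ z : ℝ × ℝ, (Real.exp (-(1/4) * (z.1 ^ 2 + z.2 ^ 2)) : ℂ) * magTrans x u z

theorem magTrans_landauProj (p : ℝ × ℝ) (u : ℝ × ℝ → ℂ) :
    magTrans p (landauProj u) = landauProj (magTrans p u) := by
  funext x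
  simp only [magTrans, landauProj]
  rw [mul_left_comm, ← integral_const_mul]
  congr 2
  funext z
  rw [magPhase_add_left, magPhase_add_right, add_assoc]
  ring

theorem MagPeriodic.landauProj {R : ℝ} {u : ℝ × ℝ → ℂ} (h : MagPeriodic R u) :
    MagPeriodic R (landauProj u) := by
  rw [magPeriodic_iff] at h ⊢
  rw [magTrans_landauProj, magTrans_landauProj, h.1, h.2]
  exact ⟨rfl, rfl⟩

theorem enorm_sub_landauProj_le {u : ℝ × ℝ → ℂ} (hu : ContDiff ℝ (⊤ : ℕ∞) u) {M : ℝ}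
    (hM : ∀ z, ‖u z‖ ≤ M) (hM' : ∀ z, ‖aOp u z‖ ≤ M) (x : ℝ × ℝ) :
    ‖u x - landauProj u x‖ₑ ≤ ∫⁻ z, singGauss (1/2) (1/4) z * ‖aOp u (x + z)‖ₑ := by
  have hd : Differentiable ℝ u := hu.differentiable (by simp)
  have h := enorm_sub_gauss_le (U := magTrans x u) (M := M)
    (contDiff_magTrans x (hu.of_le (by exact_mod_cast le_top)))
    (fun z => by rw [norm_magTrans]; exact hM _)
    (fun z => by rw [aOp_magTrans x hd, norm_magTrans]; exact hM' _)
    (by rw [aOp_magTrans x hd]; exact (contDiff_magTrans x (contDiff_aOp hu)).continuous)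
  have h0 : magTrans x u 0 = u x := by simp [magTrans, magPhase]
  have h1 : ∀ z, ‖aOp (magTrans x u) z‖ₑ = ‖aOp u (x + z)‖ₑ := by
    intro z
    rw [aOp_magTrans x hd, ← ofReal_norm, ← ofReal_norm, norm_magTrans]
  simp only [h0, h1] at h
  exact h

/-- The Bargmann kernel. -/
noncomputable def bargKer (ζ : ℂ) (y : ℝ × ℝ) : ℂ :=
  Complex.exp (ζ * ((y.1 - Complex.I * y.2) / 2) - ((1/4 * (y.1 ^ 2 + y.2 ^ 2) : ℝ) : ℂ))

/-- The Bargmann transform. -/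
noncomputable def barg (u : ℝ × ℝ → ℂ) (ζ : ℂ) : ℂ := ∫ y : ℝ × ℝ, bargKer ζ y * u y

theorem landauProj_eq (u : ℝ × ℝ → ℂ) (x : ℝ × ℝ) :
    landauProj u x = 1 / (2 * Real.pi) * ((Real.exp (-(1/4) * (x.1 ^ 2 + x.2 ^ 2)) : ℂ) *
      barg u (x.1 + Complex.I * x.2)) := by
  rw [landauProj, barg, ← integral_const_mul (Real.exp (-(1/4) * (x.1 ^ 2 + x.2 ^ 2)) : ℂ),
    ← integral_add_left_eq_self _ (-x)]
  congr 2
  funext z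
  rw [magTrans, magPhase, bargKer, ← mul_assoc, ← mul_assoc, Complex.ofReal_exp,
    Complex.ofReal_exp, ← Complex.exp_add, ← Complex.exp_add, add_neg_cancel_left]
  congr 2
  simp only [Prod.fst_add, Prod.snd_add, Prod.fst_neg, Prod.snd_neg]
  push_cast
  linear_combination ((x.2 : ℂ) * z.2 / 2) * Complex.I_sq

theorem norm_half_conj_le (y : ℝ × ℝ) :
    ‖((y.1 : ℂ) - Complex.I * y.2) / 2‖ ≤ (|y.1| + |y.2|) / 2 := by
  rw [norm_div]
  have : ‖((y.1 : ℂ) - Complex.I * y.2)‖ ≤ |y.1| + |y.2| :=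
    (norm_sub_le _ _).trans_eq (by simp)
  simpa using by gcongr

theorem norm_bargKer_mul_le {A : ℝ} (ζ : ℂ) (hζ : ‖ζ‖ ≤ A) (y : ℝ × ℝ) :
    ‖bargKer ζ y‖ * (1 + ‖((y.1 : ℂ) - Complex.I * y.2) / 2‖) ≤
      Real.exp (4 * (A + 1) ^ 2) * (Real.exp (-(1/8) * y.1 ^ 2) * Real.exp (-(1/8) * y.2 ^ 2)) := by
  set c : ℂ := ((y.1 : ℂ) - Complex.I * y.2) / 2 with hc
  have hA : 0 ≤ A := (norm_nonneg _).trans hζ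
  have hn := norm_half_conj_le y
  rw [← hc] at hn
  have h1 : ‖bargKer ζ y‖ ≤ Real.exp (A * ‖c‖ - 1/4 * (y.1 ^ 2 + y.2 ^ 2)) := by
    rw [bargKer, Complex.norm_exp, Complex.sub_re, Complex.ofReal_re]
    gcongr
    refine (Complex.re_le_norm _).trans ?_
    rw [norm_mul]
    gcongr
  have h2 : 1 + ‖c‖ ≤ Real.exp ‖c‖ := by linarith [Real.add_one_le_exp ‖c‖]
  refine (mul_le_mul h1 h2 (by positivity) (by positivity)).trans ?_
  rw [← Real.exp_add, ← Real.exp_add, ← Real.exp_add, Real.exp_le_exp]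
  have h3 : (A + 1) * ‖c‖ ≤ (A + 1) * ((|y.1| + |y.2|) / 2) := by gcongr
  nlinarith [sq_nonneg (|y.1| - 2 * (A + 1)), sq_nonneg (|y.2| - 2 * (A + 1)), sq_abs y.1,
    sq_abs y.2]

theorem integrable_gauss_prod : Integrable (fun y : ℝ × ℝ =>
    Real.exp (-(1/8) * y.1 ^ 2) * Real.exp (-(1/8) * y.2 ^ 2)) :=
  (integrable_exp_neg_mul_sq (b := 1/8) (by norm_num)).mul_prod
    (integrable_exp_neg_mul_sq (b := 1/8) (by norm_num))

theorem differentiable_barg {u : ℝ × ℝ → ℂ} (hu : Continuous u) {M : ℝ} (hM : ∀ z, ‖u z‖ ≤ M) :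
    Differentiable ℂ (barg u) := by
  intro ζ
  have hk : ∀ ζ, Continuous (bargKer ζ) := fun ζ => by unfold bargKer; fun_prop
  have hM0 : 0 ≤ M := (norm_nonneg _).trans (hM 0)
  set B : ℝ × ℝ → ℝ := fun y => Real.exp (4 * ((‖ζ‖ + 1) + 1) ^ 2) *
    (Real.exp (-(1/8) * y.1 ^ 2) * Real.exp (-(1/8) * y.2 ^ 2)) * M with hB
  have hBi : Integrable B := (integrable_gauss_prod.const_mul _).mul_const M
  have hball : ∀ ζ' ∈ Metric.ball ζ 1, ‖ζ'‖ ≤ ‖ζ‖ + 1 := by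
    intro ζ' h
    have := norm_sub_norm_le ζ' ζ
    rw [mem_ball_iff_norm] at h
    linarith
  have h := hasDerivAt_integral_of_dominated_loc_of_deriv_le (μ := (volume : Measure (ℝ × ℝ)))
    (F := fun ζ y => bargKer ζ y * u y) (x₀ := ζ) (bound := B)
    (F' := fun ζ y => bargKer ζ y * ((y.1 - Complex.I * y.2) / 2) * u y)
    (Metric.ball_mem_nhds ζ one_pos)
    (Eventually.of_forall fun ζ' => ((hk ζ').mul hu).aestronglyMeasurable)
    (by
      refine Integrable.mono' hBi ((hk ζ).mul hu).aestronglyMeasurable (ae_of_all _ fun y => ?_)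
      rw [norm_mul]
      refine mul_le_mul ?_ (hM y) (norm_nonneg _) (by positivity)
      refine le_trans ?_ (norm_bargKer_mul_le ζ (by linarith : ‖ζ‖ ≤ ‖ζ‖ + 1) y)
      exact le_mul_of_one_le_right (norm_nonneg _) (by linarith [norm_nonneg (((y.1 : ℂ) - Complex.I * y.2) / 2)]))
    (Continuous.aestronglyMeasurable
      (((hk ζ).mul (by fun_prop)).mul hu))
    (ae_of_all _ fun y ζ' hζ' => by
      rw [norm_mul, norm_mul]
      refine mul_le_mul ?_ (hM y) (norm_nonneg _) (by positivity)
      refine le_trans ?_ (norm_bargKer_mul_le ζ' (hball ζ' hζ') y)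
      gcongr
      linarith)
    hBi
    (ae_of_all _ fun y ζ' _ => by
      refine HasDerivAt.mul_const ?_ (u y)
      simpa [bargKer] using (((hasDerivAt_id ζ').mul_const _).sub_const _).cexp)
  exact h.2.differentiableAt

/-- The linear map identifying `ℝ × ℝ` with `ℂ`. -/
noncomputable def toComplexCLM : ℝ × ℝ →L[ℝ] ℂ :=
  Complex.ofRealCLM.comp (ContinuousLinearMap.fst ℝ ℝ ℝ) +
    Complex.I • Complex.ofRealCLM.comp (ContinuousLinearMap.snd ℝ ℝ ℝ)

theorem toComplexCLM_apply (x : ℝ × ℝ) : toComplexCLM x = x.1 + Complex.I * x.2 := by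
  simp [toComplexCLM]

theorem contDiff_landauProj {u : ℝ × ℝ → ℂ} (hu : Continuous u) {M : ℝ} (hM : ∀ z, ‖u z‖ ≤ M) :
    ContDiff ℝ (⊤ : ℕ∞) (landauProj u) := by
  have h1 : ContDiff ℝ (⊤ : ℕ∞) (barg u) :=
    (differentiable_barg hu hM).contDiff.restrict_scalars ℝ
  have h2 : ContDiff ℝ (⊤ : ℕ∞) (fun x : ℝ × ℝ => Real.exp (-(1/4) * (x.1 ^ 2 + x.2 ^ 2))) := by
    fun_prop
  have h3 := contDiff_const (c := (1 / (2 * Real.pi) : ℂ)).mul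
    ((Complex.ofRealCLM.contDiff.comp h2).mul (h1.comp toComplexCLM.contDiff))
  refine (congrArg (ContDiff ℝ (⊤ : ℕ∞)) (funext fun x => ?_)).mpr h3
  rw [landauProj_eq]
  simp [toComplexCLM_apply]

theorem lll_landauProj {u : ℝ × ℝ → ℂ} (hu : Continuous u) {M : ℝ} (hM : ∀ z, ‖u z‖ ≤ M) :
    LLL (landauProj u) := by
  intro x
  have h1 : HasFDerivAt (fun x => barg u (toComplexCLM x)) _ x :=
    ((differentiable_barg hu hM (toComplexCLM x)).hasDerivAt.hasFDerivAt.restrictScalars ℝ).comp x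
      toComplexCLM.hasFDerivAt
  have h2 : HasFDerivAt (fun x : ℝ × ℝ => Real.exp (-(1/4) * (x.1 ^ 2 + x.2 ^ 2))) _ x :=
    (((hasFDerivAt_fst.pow 2).add (hasFDerivAt_snd.pow 2)).const_mul (-(1/4))).exp
  have e : landauProj u = fun x => (1 / (2 * Real.pi) : ℂ) *
      ((Complex.ofRealCLM (Real.exp (-(1/4) * (x.1 ^ 2 + x.2 ^ 2)))) *
        barg u (toComplexCLM x)) := by
    funext x
    rw [landauProj_eq, toComplexCLM_apply]
    rfl
  have h3 := ((Complex.ofRealCLM.hasFDerivAt.comp x h2).mul h1).const_mul (1 / (2 * Real.pi) : ℂ)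
  change HasFDerivAt (fun x => (1 / (2 * Real.pi) : ℂ) *
      ((Complex.ofRealCLM (Real.exp (-(1/4) * (x.1 ^ 2 + x.2 ^ 2)))) *
        barg u (toComplexCLM x))) _ x at h3
  rw [← e] at h3
  rw [h3.fderiv, e]
  simp [toComplexCLM_apply]
  linear_combination ((Real.pi : ℂ)⁻¹ * 2⁻¹ * Complex.exp (-(4⁻¹ * ((x.1 : ℂ) ^ 2 + (x.2 : ℂ) ^ 2))) *
    deriv (barg u) (x.1 + Complex.I * x.2)) * Complex.I_sq

theorem integrableOn_KR {E : Type*} [NormedAddCommGroup E] {f : ℝ × ℝ → E} (hf : Continuous f)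
    (R : ℝ) : IntegrableOn f (KR R) :=
  (hf.continuousOn.integrableOn_compact ((isCompact_Icc (a := -R/2) (b := R/2)).prod
    (isCompact_Icc (a := -R/2) (b := R/2)))).mono_set
    (prod_mono Ioo_subset_Icc_self Ioo_subset_Icc_self)

theorem setIntegral_deriv_periodic {R : ℝ} (hR : 0 < R) {g g' : ℝ → ℝ}
    (hg : ∀ t, HasDerivAt g (g' t) t) (hc : Continuous g') (hp : Function.Periodic g R) :
    ∫ t in Ioo (-R/2) (R/2), g' t = 0 := by
  rw [← integral_Ioc_eq_integral_Ioo, ← intervalIntegral.integral_of_le (by linarith),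
    intervalIntegral.integral_eq_sub_of_hasDerivAt (fun t _ => hg t) (hc.intervalIntegrable _ _)]
  have := hp (-R/2)
  rw [show -R/2 + R = R/2 by ring] at this
  rw [this, sub_self]

theorem DoublyPeriodic.setIntegral_fderiv_fst {R : ℝ} (hR : 0 < R) {f : ℝ × ℝ → ℝ}
    (hf : DoublyPeriodic R f) (hd : ContDiff ℝ 1 f) :
    ∫ x in KR R, fderiv ℝ f x (1, 0) = 0 := by
  have hc : Continuous (fun x => fderiv ℝ f x (1, 0)) :=
    (hd.continuous_fderiv (by norm_num)).clm_apply continuous_const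
  have hi := integrableOn_KR hc R
  rw [IntegrableOn, volume_restrict_KR] at hi
  rw [volume_restrict_KR, integral_prod_symm _ hi]
  refine (integral_congr_ae (ae_of_all _ fun t => ?_)).trans (integral_zero _ _)
  refine setIntegral_deriv_periodic hR (g := fun s => f (s, t)) (fun s => ?_)
    (hc.comp (by fun_prop : Continuous fun s : ℝ => (s, t))) (fun s => (hf (s, t)).1)
  exact (hd.differentiable (by norm_num) (s, t)).hasFDerivAt.comp_hasDerivAt s
    ((hasDerivAt_id s).prodMk (hasDerivAt_const s t))

theorem DoublyPeriodic.setIntegral_fderiv_snd {R : ℝ} (hR : 0 < R) {f : ℝ × ℝ → ℝ}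
    (hf : DoublyPeriodic R f) (hd : ContDiff ℝ 1 f) :
    ∫ x in KR R, fderiv ℝ f x (0, 1) = 0 := by
  have hc : Continuous (fun x => fderiv ℝ f x (0, 1)) :=
    (hd.continuous_fderiv (by norm_num)).clm_apply continuous_const
  have hi := integrableOn_KR hc R
  rw [IntegrableOn, volume_restrict_KR] at hi
  rw [volume_restrict_KR, integral_prod _ hi]
  refine (integral_congr_ae (ae_of_all _ fun s => ?_)).trans (integral_zero _ _)
  refine setIntegral_deriv_periodic hR (g := fun t => f (s, t)) (fun t => ?_)
    (hc.comp (by fun_prop : Continuous fun t : ℝ => (s, t))) (fun t => (hf (s, t)).2)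
  exact (hd.differentiable (by norm_num) (s, t)).hasFDerivAt.comp_hasDerivAt t
    ((hasDerivAt_const t s).prodMk (hasDerivAt_id t))

theorem fderiv_D1 {u : ℝ × ℝ → ℂ} (hu : ContDiff ℝ (⊤ : ℕ∞) u) (x v : ℝ × ℝ) :
    fderiv ℝ (D1 u) x v = fderiv ℝ (fderiv ℝ u) x v (1, 0)
      + Complex.I * (v.2 / 2) * u x + Complex.I * (x.2 / 2) * fderiv ℝ u x v := by
  have h1 := (hu.differentiable (by simp) x).hasFDerivAt
  have h2 := (((hu.fderiv_right (m := (⊤ : ℕ∞)) (by simp)).differentiable (by simp) x).hasFDerivAt).clm_apply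
    (hasFDerivAt_const ((1, 0) : ℝ × ℝ) x)
  have h3 : HasFDerivAt (fun x : ℝ × ℝ => ((A0 x).1 : ℂ))
      (Complex.ofRealCLM.comp ((-(1/2) : ℝ) • ContinuousLinearMap.snd ℝ ℝ ℝ)) x := by
    refine Complex.ofRealCLM.hasFDerivAt.comp x ?_
    refine (hasFDerivAt_snd.const_mul (-(1/2) : ℝ)).congr_of_eventuallyEq
      (Eventually.of_forall fun y => ?_)
    change -y.2 / 2 = -(1/2) * y.2
    ring
  have h4 := h2.sub ((h3.const_mul Complex.I).mul h1)
  change HasFDerivAt (D1 u) _ x at h4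
  rw [h4.fderiv]
  simp [A0]
  ring

theorem fderiv_D2 {u : ℝ × ℝ → ℂ} (hu : ContDiff ℝ (⊤ : ℕ∞) u) (x v : ℝ × ℝ) :
    fderiv ℝ (D2 u) x v = fderiv ℝ (fderiv ℝ u) x v (0, 1)
      - Complex.I * (v.1 / 2) * u x - Complex.I * (x.1 / 2) * fderiv ℝ u x v := by
  have h1 := (hu.differentiable (by simp) x).hasFDerivAt
  have h2 := (((hu.fderiv_right (m := (⊤ : ℕ∞)) (by simp)).differentiable (by simp) x).hasFDerivAt).clm_apply
    (hasFDerivAt_const ((0, 1) : ℝ × ℝ) x)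
  have h3 : HasFDerivAt (fun x : ℝ × ℝ => ((A0 x).2 : ℂ))
      (Complex.ofRealCLM.comp ((1/2 : ℝ) • ContinuousLinearMap.fst ℝ ℝ ℝ)) x := by
    refine Complex.ofRealCLM.hasFDerivAt.comp x ?_
    refine (hasFDerivAt_fst.const_mul (1/2 : ℝ)).congr_of_eventuallyEq
      (Eventually.of_forall fun y => ?_)
    change y.1 / 2 = 1/2 * y.1
    ring
  have h4 := h2.sub ((h3.const_mul Complex.I).mul h1)
  change HasFDerivAt (D2 u) _ x at h4
  rw [h4.fderiv]
  simp [A0]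
  ring

theorem fderiv_im_mul_conj {f g : ℝ × ℝ → ℂ} {x : ℝ × ℝ} (hf : DifferentiableAt ℝ f x)
    (hg : DifferentiableAt ℝ g x) (v : ℝ × ℝ) :
    fderiv ℝ (fun x => (f x * (starRingEnd ℂ) (g x)).im) x v =
      (fderiv ℝ f x v * (starRingEnd ℂ) (g x) + f x * (starRingEnd ℂ) (fderiv ℝ g x v)).im := by
  have h1 : HasFDerivAt (fun x => (starRingEnd ℂ) (g x)) _ x :=
    (Complex.conjCLE.toContinuousLinearMap.hasFDerivAt).comp x hg.hasFDerivAt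
  have h2 := Complex.imCLM.hasFDerivAt.comp x (hf.hasFDerivAt.mul h1)
  change HasFDerivAt (fun x => (f x * (starRingEnd ℂ) (g x)).im) _ x at h2
  rw [h2.fderiv]
  simp
  ring

theorem norm_aOp_sq {u : ℝ × ℝ → ℂ} (hu : ContDiff ℝ (⊤ : ℕ∞) u) (x : ℝ × ℝ) :
    ‖aOp u x‖ ^ 2 = ‖D1 u x‖ ^ 2 + ‖D2 u x‖ ^ 2 - ‖u x‖ ^ 2
      - (fderiv ℝ (fun x => (D2 u x * (starRingEnd ℂ) (u x)).im) x (1, 0)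
        - fderiv ℝ (fun x => (D1 u x * (starRingEnd ℂ) (u x)).im) x (0, 1)) := by
  have hd := hu.differentiable (by simp) x
  rw [fderiv_im_mul_conj ((contDiff_D2 hu).differentiable (by simp) x) hd,
    fderiv_im_mul_conj ((contDiff_D1 hu).differentiable (by simp) x) hd,
    fderiv_D1 hu, fderiv_D2 hu]
  have hs : fderiv ℝ (fderiv ℝ u) x (1, 0) (0, 1) = fderiv ℝ (fderiv ℝ u) x (0, 1) (1, 0) :=
    hu.contDiffAt.isSymmSndFDerivAt (by simpa using WithTop.coe_le_coe.2 (le_top : (2 : ℕ∞) ≤ ⊤)) _ _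
  rw [hs, aOp, D1, D2, A0]
  generalize fderiv ℝ (fderiv ℝ u) x (0, 1) (1, 0) = w
  generalize fderiv ℝ u x (1, 0) = p
  generalize fderiv ℝ u x (0, 1) = q
  generalize u x = a
  simp only [← Complex.normSq_eq_norm_sq, Complex.normSq_apply]
  simp
  ring

/-- Integration by parts: the magnetic kinetic energy in terms of the annihilation operator. -/
theorem setIntegral_kinetic {R : ℝ} (hR : 0 < R) {u : ℝ × ℝ → ℂ} (hu : ContDiff ℝ (⊤ : ℕ∞) u)
    (hp : MagPeriodic R u) :
    ∫ x in KR R, (‖D1 u x‖ ^ 2 + ‖D2 u x‖ ^ 2) =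
      (∫ x in KR R, ‖aOp u x‖ ^ 2) + ∫ x in KR R, ‖u x‖ ^ 2 := by
  have hd := hu.differentiable (by simp)
  have h1 := contDiff_D1 hu
  have h2 := contDiff_D2 hu
  have c0 := hu.continuous
  have c1 := h1.continuous
  have c2 := h2.continuous
  have hj : ∀ f : ℝ × ℝ → ℂ, ContDiff ℝ (⊤ : ℕ∞) f →
      ContDiff ℝ 1 (fun x => (f x * (starRingEnd ℂ) (u x)).im) := fun f hf =>
    (Complex.imCLM.contDiff.comp (hf.mul (Complex.conjCLE.contDiff.comp hu))).of_le
      (by exact_mod_cast le_top)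
  have z1 := (((hp.D2 hd).mul_conj hp).comp Complex.im).setIntegral_fderiv_fst hR (hj _ h2)
  have z2 := (((hp.D1 hd).mul_conj hp).comp Complex.im).setIntegral_fderiv_snd hR (hj _ h1)
  have k1 : Continuous (fun x => fderiv ℝ (fun x => (D2 u x * (starRingEnd ℂ) (u x)).im) x (1, 0)) :=
    ((hj _ h2).continuous_fderiv (by norm_num)).clm_apply continuous_const
  have k2 : Continuous (fun x => fderiv ℝ (fun x => (D1 u x * (starRingEnd ℂ) (u x)).im) x (0, 1)) :=
    ((hj _ h1).continuous_fderiv (by norm_num)).clm_apply continuous_const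
  have i1 := integrableOn_KR k1 R
  have i2 := integrableOn_KR k2 R
  have i3 : IntegrableOn (fun x => ‖D1 u x‖ ^ 2 + ‖D2 u x‖ ^ 2) (KR R) :=
    integrableOn_KR (by fun_prop) R
  have i4 : IntegrableOn (fun x => ‖u x‖ ^ 2) (KR R) := integrableOn_KR (by fun_prop) R
  simp only [norm_aOp_sq hu]
  rw [integral_sub, integral_sub i3 i4, integral_sub i1 i2, z1, z2]
  · ring
  · exact i3.sub i4
  · exact i1.sub i2

/-- The `k`-th power integral of `‖u‖` over the square `K_R`. -/
noncomputable def powInt (R : ℝ) (k : ℕ) (u : ℝ × ℝ → ℂ) : ℝ := ∫ x in KR R, ‖u x‖ ^ k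

theorem powInt_nonneg (R : ℝ) (k : ℕ) (u : ℝ × ℝ → ℂ) : 0 ≤ powInt R k u :=
  integral_nonneg fun _ => by positivity

theorem integrableOn_norm_pow {u : ℝ × ℝ → ℂ} (hu : Continuous u) (R : ℝ) (k : ℕ) :
    IntegrableOn (fun x => ‖u x‖ ^ k) (KR R) :=
  integrableOn_KR (by fun_prop) R

theorem powInt_const_mul (R : ℝ) (k : ℕ) (c : ℂ) (u : ℝ × ℝ → ℂ) :
    powInt R k (fun x => c * u x) = ‖c‖ ^ k * powInt R k u := by
  simp only [powInt, norm_mul, mul_pow, integral_const_mul]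

theorem ofReal_powInt {u : ℝ × ℝ → ℂ} (hu : Continuous u) (R : ℝ) (k : ℕ) :
    ENNReal.ofReal (powInt R k u) = ∫⁻ x in KR R, ‖u x‖ₑ ^ k := by
  rw [powInt, ofReal_integral_eq_lintegral_ofReal (integrableOn_norm_pow hu R k)
    (ae_of_all _ fun x => by positivity)]
  refine lintegral_congr fun x => ?_
  rw [ENNReal.ofReal_pow (norm_nonneg _), ofReal_norm]

theorem setIntegral_KR_const {R : ℝ} (hR : 0 ≤ R) (a : ℝ) : ∫ _ in KR R, a = R ^ 2 * a := by
  rw [setIntegral_const, measureReal_def, volume_KR hR, ENNReal.toReal_ofReal (sq_nonneg R),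
    smul_eq_mul]

theorem FAb_eq {v : ℝ × ℝ → ℂ} (hv : Continuous v) (R : ℝ) :
    FAb R v = -powInt R 2 v + 1/2 * powInt R 4 v := by
  rw [FAb, integral_add (integrableOn_KR (by fun_prop) R) (integrableOn_KR (by fun_prop) R),
    integral_neg, integral_const_mul]
  rfl

theorem G2_eq {R : ℝ} (hR : 0 < R) (b : ℝ) {u : ℝ × ℝ → ℂ} (hu : ContDiff ℝ (⊤ : ℕ∞) u)
    (hp : MagPeriodic R u) :
    G2 b R u = b * (powInt R 2 (aOp u) + powInt R 2 u) - powInt R 2 u + 1/2 * powInt R 4 u := by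
  have c0 := hu.continuous
  have c1 := (contDiff_D1 hu).continuous
  have c2 := (contDiff_D2 hu).continuous
  rw [G2, integral_add (integrableOn_KR (by fun_prop) R) (integrableOn_KR (by fun_prop) R),
    integral_sub (integrableOn_KR (by fun_prop) R) (integrableOn_KR (by fun_prop) R),
    integral_const_mul, integral_const_mul, setIntegral_kinetic hR hu hp]
  rfl

theorem powInt_completed_square {R : ℝ} (hR : 0 ≤ R) {u : ℝ × ℝ → ℂ} (hu : Continuous u) (β : ℝ) :
    -(1/2 * β ^ 2 * R ^ 2) ≤ 1/2 * powInt R 4 u - β * powInt R 2 u := by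
  have h : ∫ _ in KR R, -(1/2 * β ^ 2) ≤ ∫ x in KR R, (1/2 * ‖u x‖ ^ 4 - β * ‖u x‖ ^ 2) := by
    refine integral_mono (integrableOn_KR continuous_const R) (integrableOn_KR (by fun_prop) R) ?_
    intro x
    simp only
    nlinarith [sq_nonneg (‖u x‖ ^ 2 - β)]
  rw [setIntegral_KR_const hR, integral_sub ((integrableOn_norm_pow hu R 4).const_mul _)
    ((integrableOn_norm_pow hu R 2).const_mul _), integral_const_mul, integral_const_mul] at h
  simp only [powInt]
  linarith

theorem magPeriodic_zero (R : ℝ) : MagPeriodic R (fun _ => 0) := fun x => by simp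

theorem lll_zero : LLL (fun _ => 0) := fun x => by simp

theorem G2_zero (b R : ℝ) : G2 b R (fun _ => 0) = 0 := by simp [G2, D1, D2]

theorem FAb_zero (R : ℝ) : FAb R (fun _ => 0) = 0 := by simp [FAb]

theorem bddBelow_FAb {R : ℝ} (hR : 0 ≤ R) :
    BddBelow {E : ℝ | ∃ u : ℝ × ℝ → ℂ, ContDiff ℝ (⊤ : ℕ∞) u ∧ MagPeriodic R u ∧ LLL u ∧
      E = FAb R u} := by
  refine ⟨-(1/2 * R ^ 2), ?_⟩
  rintro _ ⟨u, hu, -, -, rfl⟩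
  have := powInt_completed_square hR hu.continuous 1
  rw [FAb_eq hu.continuous]
  linarith

theorem cAb_le {R : ℝ} (hR : 0 ≤ R) {u : ℝ × ℝ → ℂ} (hu : ContDiff ℝ (⊤ : ℕ∞) u)
    (hp : MagPeriodic R u) (hl : LLL u) : cAb R ≤ FAb R u :=
  csInf_le (bddBelow_FAb hR) ⟨u, hu, hp, hl, rfl⟩

theorem cAb_nonpos {R : ℝ} (hR : 0 ≤ R) : cAb R ≤ 0 :=
  (cAb_le hR contDiff_const (magPeriodic_zero R) lll_zero).trans_eq (FAb_zero R)

theorem mp_le {b R : ℝ} (hb : 0 ≤ b) (hR : 0 < R) {u : ℝ × ℝ → ℂ} (hu : ContDiff ℝ (⊤ : ℕ∞) u)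
    (hp : MagPeriodic R u) : mp b R ≤ G2 b R u := by
  refine csInf_le ⟨-(1/2 * R ^ 2), ?_⟩ ⟨u, hu, hp, rfl⟩
  rintro _ ⟨u, hu, hp, rfl⟩
  have h := powInt_completed_square hR.le hu.continuous 1
  rw [G2_eq hR b hu hp]
  have := mul_nonneg hb (add_nonneg (powInt_nonneg R 2 (aOp u)) (powInt_nonneg R 2 u))
  linarith

theorem le_mp {b R X : ℝ}
    (h : ∀ u : ℝ × ℝ → ℂ, ContDiff ℝ (⊤ : ℕ∞) u → MagPeriodic R u → X ≤ G2 b R u) :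
    X ≤ mp b R := by
  refine le_csInf ⟨_, _, contDiff_const, magPeriodic_zero R, rfl⟩ ?_
  rintro _ ⟨u, hu, hp, rfl⟩
  exact h u hu hp

theorem LLL.const_mul {u : ℝ × ℝ → ℂ} (hl : LLL u) (hu : ContDiff ℝ (⊤ : ℕ∞) u) (c : ℂ) :
    LLL (fun x => c * u x) := by
  intro x
  have h := hl x
  rw [fderiv_const_mul (hu.differentiable (by simp) x)]
  simp only [smul_apply, smul_eq_mul]
  linear_combination c * h

theorem norm_ofReal_sqrt_pow {τ : ℝ} (hτ : 0 ≤ τ) (k : ℕ) :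
    ‖((Real.sqrt τ : ℝ) : ℂ)‖ ^ (2 * k) = τ ^ k := by
  rw [Complex.norm_real, Real.norm_of_nonneg (Real.sqrt_nonneg _), pow_mul, Real.sq_sqrt hτ]

theorem cAb_le_scaled {R : ℝ} (hR : 0 ≤ R) {v : ℝ × ℝ → ℂ} (hv : ContDiff ℝ (⊤ : ℕ∞) v)
    (hp : MagPeriodic R v) (hl : LLL v) {τ : ℝ} (hτ : 0 ≤ τ) :
    cAb R ≤ -(τ * powInt R 2 v) + 1/2 * (τ ^ 2 * powInt R 4 v) := by
  have h := cAb_le hR (contDiff_const.mul hv) (hp.const_mul (Real.sqrt τ : ℂ))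
    (hl.const_mul hv _)
  rw [FAb_eq (contDiff_const.mul hv).continuous, powInt_const_mul, powInt_const_mul,
    norm_ofReal_sqrt_pow hτ 1, norm_ofReal_sqrt_pow hτ 2, pow_one] at h
  exact h

theorem mp_le_sq_mul_cAb {b R : ℝ} (hb : 0 < b) (hR : 0 < R) :
    mp b R ≤ (max (1 - b) 0) ^ 2 * cAb R := by
  rcases le_or_gt 1 b with h | h
  · rw [max_eq_right (by linarith)]
    have := mp_le hb.le hR contDiff_const (magPeriodic_zero R)
    rw [G2_zero] at this
    simpa using this
  · rw [max_eq_left (by linarith)]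
    set β := 1 - b with hβ
    have hβ0 : 0 < β := by linarith
    rw [mul_comm, ← div_le_iff₀ (by positivity)]
    refine le_csInf ⟨_, _, contDiff_const, magPeriodic_zero R, lll_zero, rfl⟩ ?_
    rintro _ ⟨v, hv, hp, hl, rfl⟩
    rw [div_le_iff₀ (by positivity)]
    have hl' := hl.const_mul hv (Real.sqrt β : ℂ)
    have hv' : ContDiff ℝ (⊤ : ℕ∞) (fun x => (Real.sqrt β : ℂ) * v x) := contDiff_const.mul hv
    have hp' := hp.const_mul (Real.sqrt β : ℂ)
    refine (mp_le hb.le hR hv' hp').trans_eq ?_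
    have h0 : powInt R 2 (aOp fun x => (Real.sqrt β : ℂ) * v x) = 0 := by
      simp [powInt, (lll_iff_aOp_eq_zero _).1 hl']
    rw [G2_eq hR b hv' hp', h0, powInt_const_mul, powInt_const_mul,
      norm_ofReal_sqrt_pow hβ0.le 1, norm_ofReal_sqrt_pow hβ0.le 2, FAb_eq hv.continuous, hβ]
    ring

theorem exists_lll_approx : ∃ C : ℝ, 0 ≤ C ∧ ∀ R : ℝ, 2 ≤ R → ∀ u : ℝ × ℝ → ℂ,
    ContDiff ℝ (⊤ : ℕ∞) u → MagPeriodic R u → ∃ v : ℝ × ℝ → ℂ, ContDiff ℝ (⊤ : ℕ∞) v ∧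
      MagPeriodic R v ∧ LLL v ∧
      powInt R 2 (fun x => u x - v x) ≤ C * powInt R 2 (aOp u) ∧
      powInt R 4 (fun x => u x - v x) ≤ C * powInt R 2 (aOp u) ^ 2 := by
  obtain ⟨C, hC, hconv⟩ := exists_convolution_bounds
  refine ⟨C.toReal, ENNReal.toReal_nonneg, fun R hR u hu hp => ?_⟩
  have hR0 : 0 < R := by linarith
  have hac : Continuous (aOp u) := (contDiff_aOp hu).continuous
  have hap := hp.aOp (hu.differentiable (by simp))
  obtain ⟨M₁, hM₁⟩ := hp.norm.exists_bound hR0 hu.continuous.norm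
  obtain ⟨M₂, hM₂⟩ := hap.norm.exists_bound hR0 hac.norm
  have hv := contDiff_landauProj hu.continuous hM₁
  have hw : Continuous (fun x => u x - landauProj u x) := hu.continuous.sub hv.continuous
  have hφ : DoublyPeriodic R (fun x => ‖aOp u x‖ₑ) := by
    simpa only [ofReal_norm] using hap.norm.comp ENNReal.ofReal
  obtain ⟨h2, h4⟩ := hconv R hR _ (fun x => ‖u x - landauProj u x‖ₑ) hφ hac.measurable.enorm
    (enorm_sub_landauProj_le hu (M := max M₁ M₂) (fun z => (hM₁ z).trans (le_max_left _ _))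
      (fun z => (hM₂ z).trans (le_max_right _ _)))
  refine ⟨landauProj u, hv, hp.landauProj, lll_landauProj hu.continuous hM₁, ?_, ?_⟩
  · rw [← ENNReal.ofReal_le_ofReal_iff (mul_nonneg ENNReal.toReal_nonneg (powInt_nonneg _ _ _)),
      ENNReal.ofReal_mul ENNReal.toReal_nonneg, ENNReal.ofReal_toReal hC.ne, ofReal_powInt hw,
      ofReal_powInt hac]
    exact h2
  · rw [← ENNReal.ofReal_le_ofReal_iff (mul_nonneg ENNReal.toReal_nonneg (sq_nonneg _)),
      ENNReal.ofReal_mul ENNReal.toReal_nonneg, ENNReal.ofReal_toReal hC.ne, ofReal_powInt hw,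
      ENNReal.ofReal_pow (powInt_nonneg _ _ _), ofReal_powInt hac]
    exact h4

theorem add_sq_le_weighted {t : ℝ} (ht : 0 < t) (x y : ℝ) :
    (x + y) ^ 2 ≤ (1 + t) * x ^ 2 + (1 + 1 / t) * y ^ 2 := by
  have h : (1 + t) * x ^ 2 + (1 + 1 / t) * y ^ 2 - (x + y) ^ 2 = (t * x - y) ^ 2 / t := by
    field_simp
    ring
  have : 0 ≤ (t * x - y) ^ 2 / t := by positivity
  linarith

theorem add_pow_four_le_weighted {s : ℝ} (hs : 0 < s) (hs1 : s ≤ 1) (x y : ℝ) :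
    (x + y) ^ 4 ≤ (1 + s) * x ^ 4 + 125 / s ^ 3 * y ^ 4 := by
  have ht : 0 < s / 4 := by positivity
  have h1 := add_sq_le_weighted ht x y
  have h2 := add_sq_le_weighted ht ((1 + s / 4) * x ^ 2) ((1 + 1 / (s / 4)) * y ^ 2)
  have h3 : (x + y) ^ 4 ≤ ((1 + s / 4) * x ^ 2 + (1 + 1 / (s / 4)) * y ^ 2) ^ 2 := by
    calc (x + y) ^ 4 = ((x + y) ^ 2) ^ 2 := by ring
      _ ≤ _ := by gcongr
  have h4 : (1 + s / 4) ^ 3 ≤ 1 + s := by nlinarith [mul_pos hs hs, mul_nonneg hs.le (sub_nonneg.2 hs1)]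
  have h5 : 1 + 1 / (s / 4) ≤ 5 / s := by
    rw [show 1 + 1 / (s / 4) = (s + 4) / s by field_simp]
    gcongr
    linarith
  have h6 : (1 + 1 / (s / 4)) ^ 3 ≤ 125 / s ^ 3 := by
    calc (1 + 1 / (s / 4)) ^ 3 ≤ (5 / s) ^ 3 := by gcongr
      _ = _ := by rw [div_pow]; norm_num
  calc (x + y) ^ 4 ≤ (1 + s / 4) ^ 3 * x ^ 4 + (1 + 1 / (s / 4)) ^ 3 * y ^ 4 := by
        refine (h3.trans h2).trans_eq ?_
        ring
    _ ≤ _ := by gcongr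

theorem powInt_two_le {R s : ℝ} (hs : 0 < s) {u v : ℝ × ℝ → ℂ} (hu : Continuous u)
    (hv : Continuous v) : powInt R 2 u ≤
      (1 + s) * powInt R 2 v + (1 + 1 / s) * powInt R 2 (fun x => u x - v x) := by
  have i1 := (integrableOn_norm_pow hv R 2).const_mul (1 + s)
  have hw : Continuous (fun x => u x - v x) := hu.sub hv
  have i2 := (integrableOn_norm_pow hw R 2).const_mul (1 + 1 / s)
  simp only [powInt]
  rw [← integral_const_mul, ← integral_const_mul, ← integral_add i1 i2]
  refine integral_mono (integrableOn_norm_pow hu R 2) (i1.add i2) fun x => ?_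
  refine le_trans ?_ (add_sq_le_weighted hs _ _)
  gcongr
  simpa using norm_add_le (v x) (u x - v x)

theorem powInt_four_le {R s : ℝ} (hs : 0 < s) (hs1 : s ≤ 1) {u v : ℝ × ℝ → ℂ} (hu : Continuous u)
    (hv : Continuous v) : powInt R 4 v ≤
      (1 + s) * powInt R 4 u + 125 / s ^ 3 * powInt R 4 (fun x => u x - v x) := by
  have i1 := (integrableOn_norm_pow hu R 4).const_mul (1 + s)
  have hw : Continuous (fun x => u x - v x) := hu.sub hv
  have i2 := (integrableOn_norm_pow hw R 4).const_mul (125 / s ^ 3)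
  simp only [powInt]
  rw [← integral_const_mul, ← integral_const_mul, ← integral_add i1 i2]
  refine integral_mono (integrableOn_norm_pow hv R 4) (i1.add i2) fun x => ?_
  refine le_trans ?_ (add_pow_four_le_weighted hs hs1 _ _)
  gcongr
  simpa using norm_sub_le (u x) (u x - v x)

/-- The elementary inequality combining the estimates on the lowest Landau level approximation:
`T` is the kinetic excess, `S`, `Q` are the quadratic and quartic integrals of the function,
`V₂`, `V₄` those of its approximation and `W₂`, `W₄` those of the difference. -/
theorem energy_lower_bound {C β s R c T S Q V₂ V₄ W₂ W₄ : ℝ} (hC : 0 ≤ C) (hβ : 0 < β)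
    (hβ1 : β ≤ 1/2) (hs : 0 < s) (hs1 : s ≤ 1/4) (hR : 2 ≤ R) (hc : c ≤ 0) (hT : 0 ≤ T)
    (hW₂ : W₂ ≤ C * T) (hW₄ : W₄ ≤ C * T ^ 2)
    (hS : S ≤ (1 + s) * V₂ + (1 + 1 / s) * W₂)
    (hV₄ : V₄ ≤ (1 + s) * Q + 125 / s ^ 3 * W₄)
    (hsq : -(1/2 * β ^ 2 * R ^ 2) ≤ 1/2 * Q - β * S)
    (hscal : ∀ τ, 0 ≤ τ → c ≤ -(τ * V₂) + 1/2 * (τ ^ 2 * V₄)) :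
    β ^ 2 * ((1 + 4 * s) * c - (2 * C ^ 2 + 63 * C) / s ^ 3 * β ^ 2 * R ^ 4) ≤
      (1 - β) * T - β * S + 1/2 * Q := by
  have hR0 : 0 < R := by linarith
  rcases le_or_gt 0 ((1 - β) * T - β * S + 1/2 * Q) with hG | hG
  · refine le_trans ?_ hG
    have h1 : (1 + 4 * s) * c ≤ 0 := mul_nonpos_of_nonneg_of_nonpos (by linarith) hc
    have h2 : 0 ≤ (2 * C ^ 2 + 63 * C) / s ^ 3 * β ^ 2 * R ^ 4 := by positivity
    exact mul_nonpos_of_nonneg_of_nonpos (by positivity) (by linarith)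
  have hTle : T ≤ β ^ 2 * R ^ 2 := by nlinarith
  have hmain : β ^ 2 * ((1 + 4 * s) * c) ≤ -(β * ((1 + s) * V₂)) + 1/2 * (V₄ / (1 + s)) := by
    have h1 := hscal (1 / (β * (1 + s) ^ 2)) (by positivity)
    have h2 : β ^ 2 * (1 + s) ^ 3 * c ≤ β ^ 2 * (1 + s) ^ 3 *
        (-(1 / (β * (1 + s) ^ 2) * V₂) + 1/2 * ((1 / (β * (1 + s) ^ 2)) ^ 2 * V₄)) := by gcongr
    have h3 : β ^ 2 * (1 + s) ^ 3 *
        (-(1 / (β * (1 + s) ^ 2) * V₂) + 1/2 * ((1 / (β * (1 + s) ^ 2)) ^ 2 * V₄)) =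
        -(β * ((1 + s) * V₂)) + 1/2 * (V₄ / (1 + s)) := by
      field_simp
    have h4 : (1 + s) ^ 3 ≤ 1 + 4 * s := by nlinarith [mul_pos hs hs]
    have h5 : (1 + 4 * s) * c ≤ (1 + s) ^ 3 * c := mul_le_mul_of_nonpos_right h4 hc
    have h6 : β ^ 2 * ((1 + 4 * s) * c) ≤ β ^ 2 * ((1 + s) ^ 3 * c) := by gcongr
    linarith
  have hquart : V₄ / (1 + s) ≤ Q + 125 / s ^ 3 * (C * T ^ 2) := by
    rw [div_le_iff₀ (by linarith)]
    have h1 : 125 / s ^ 3 * W₄ ≤ 125 / s ^ 3 * (C * T ^ 2) := by gcongr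
    have h2 : 0 ≤ 125 / s ^ 3 * (C * T ^ 2) * s := by positivity
    linarith
  have hquad : β * S ≤ β * ((1 + s) * V₂) + (T / 2 + 2 * C ^ 2 / s ^ 3 * β ^ 4 * R ^ 4) := by
    have h1 : 1 + 1 / s ≤ 2 / s := by
      rw [show 1 + 1 / s = (s + 1) / s by field_simp]
      gcongr
      linarith
    have h2 : (1 + 1 / s) * W₂ ≤ 2 / s * (C * T) := by
      calc (1 + 1 / s) * W₂ ≤ (1 + 1 / s) * (C * T) := by gcongr
        _ ≤ _ := by gcongr
    have h3 : β * S ≤ β * ((1 + s) * V₂ + 2 / s * (C * T)) := by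
      gcongr
      linarith
    have h4 : 2 * C * β / s * T ≤ (1/2 + 2 * C ^ 2 * β ^ 2 / s ^ 2) * T := by
      gcongr
      have e : 1/2 + 2 * C ^ 2 * β ^ 2 / s ^ 2 - 2 * C * β / s = 1/2 * (1 - 2 * C * β / s) ^ 2 := by
        ring
      have : 0 ≤ 1/2 * (1 - 2 * C * β / s) ^ 2 := by positivity
      linarith
    have h5 : 2 * C ^ 2 * β ^ 2 / s ^ 2 * T ≤ 2 * C ^ 2 * β ^ 2 / s ^ 3 * (β ^ 2 * R ^ 4) := by
      have hs3 : s ^ 3 ≤ s ^ 2 := pow_le_pow_of_le_one hs.le (by linarith) (by norm_num)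
      have hR4 : R ^ 2 ≤ R ^ 4 := pow_le_pow_right₀ (by linarith) (by norm_num)
      have hT4 : T ≤ β ^ 2 * R ^ 4 := hTle.trans (by gcongr)
      gcongr
    have e1 : β * (2 / s * (C * T)) = 2 * C * β / s * T := by ring
    have e2 : 2 * C ^ 2 * β ^ 2 / s ^ 3 * (β ^ 2 * R ^ 4) = 2 * C ^ 2 / s ^ 3 * β ^ 4 * R ^ 4 := by
      ring
    linarith
  have hT2 : 125 / s ^ 3 * (C * T ^ 2) ≤ 126 * C / s ^ 3 * β ^ 4 * R ^ 4 := by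
    have h1 : 125 / s ^ 3 * (C * T ^ 2) ≤ 126 / s ^ 3 * (C * (β ^ 2 * R ^ 2) ^ 2) := by
      gcongr
      norm_num
    exact h1.trans_eq (by ring)
  have hbT : T / 2 ≤ (1 - β) * T := by nlinarith
  have e : β ^ 2 * ((1 + 4 * s) * c - (2 * C ^ 2 + 63 * C) / s ^ 3 * β ^ 2 * R ^ 4) =
      β ^ 2 * ((1 + 4 * s) * c) - 2 * C ^ 2 / s ^ 3 * β ^ 4 * R ^ 4
        - 1/2 * (126 * C / s ^ 3 * β ^ 4 * R ^ 4) := by ring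
  linarith

theorem exists_le_mp : ∃ C : ℝ, 0 < C ∧ ∀ b R σ : ℝ, 2 ≤ R → 1/2 ≤ b → 0 < σ → σ < 1/2 →
    (max (1 - b) 0) ^ 2 * ((1 + 2 * σ) * cAb R - C / σ ^ 3 * (1 - b) ^ 2 * R ^ 4) ≤ mp b R := by
  obtain ⟨C, hC, happ⟩ := exists_lll_approx
  refine ⟨8 * (2 * C ^ 2 + 63 * C) + 1, by positivity, fun b R σ hR hb hσ hσ1 => ?_⟩
  have hR0 : 0 < R := by linarith
  refine le_mp fun u hu hp => ?_
  have hT := powInt_nonneg R 2 (aOp u)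
  rw [G2_eq hR0 b hu hp]
  rcases le_or_gt 1 b with h | h
  · rw [max_eq_right (by linarith)]
    have hS := powInt_nonneg R 2 u
    have hQ := powInt_nonneg R 4 u
    nlinarith
  · rw [max_eq_left (by linarith)]
    obtain ⟨v, hv, hvp, hvl, hW₂, hW₄⟩ := happ R hR u hu hp
    have hs : 0 < σ / 2 := by positivity
    have key := energy_lower_bound (β := 1 - b) hC (by linarith) (by linarith) hs (by linarith) hR
      (cAb_nonpos hR0.le) hT hW₂ hW₄ (powInt_two_le hs hu.continuous hv.continuous)
      (powInt_four_le hs (by linarith) hu.continuous hv.continuous)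
      (powInt_completed_square hR0.le hu.continuous (1 - b))
      (fun τ hτ => cAb_le_scaled hR0.le hv hvp hvl hτ)
    have h1 : (2 * C ^ 2 + 63 * C) / (σ / 2) ^ 3 * (1 - b) ^ 2 * R ^ 4 ≤
        (8 * (2 * C ^ 2 + 63 * C) + 1) / σ ^ 3 * (1 - b) ^ 2 * R ^ 4 := by
      rw [show (2 * C ^ 2 + 63 * C) / (σ / 2) ^ 3 = 8 * (2 * C ^ 2 + 63 * C) / σ ^ 3 by
        field_simp; ring]
      gcongr
      linarith
    have h2 : (1 - b) ^ 2 *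
        ((1 + 2 * σ) * cAb R - (8 * (2 * C ^ 2 + 63 * C) + 1) / σ ^ 3 * (1 - b) ^ 2 * R ^ 4) ≤
        (1 - b) ^ 2 * ((1 + 4 * (σ / 2)) * cAb R -
          (2 * C ^ 2 + 63 * C) / (σ / 2) ^ 3 * (1 - b) ^ 2 * R ^ 4) := by
      refine mul_le_mul_of_nonneg_left ?_ (sq_nonneg _)
      linarith
    linarith

/-- Relation between the periodic ground state energy and the Abrikosov energy. -/
theorem stmt_14 :
    (∀ b R : ℝ, 0 < b → 0 < R → (∃ N : ℕ, 0 < N ∧ R ^ 2 = 2 * Real.pi * N) →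
      mp b R ≤ (max (1 - b) 0) ^ 2 * cAb R) ∧
    ∃ ε₀ ∈ Ioo (0:ℝ) 1, ∃ C : ℝ, 0 < C ∧
      ∀ b R σ : ℝ, 2 ≤ R → (∃ N : ℕ, 0 < N ∧ R ^ 2 = 2 * Real.pi * N) →
        1 - ε₀ ≤ b → 0 < σ → σ < 1/2 →
        mp b R ≥ (max (1 - b) 0) ^ 2 *
          ((1 + 2 * σ) * cAb R - C / σ ^ 3 * (1 - b) ^ 2 * R ^ 4) :=
  ⟨fun _ _ hb hR _ => mp_le_sq_mul_cAb hb hR, by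
    obtain ⟨C, hC, h⟩ := exists_le_mp
    refine ⟨1/2, by norm_num, C, hC, fun b R σ hR _ hb => h b R σ hR ?_⟩
    linarith⟩
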